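/- arXiv:2511.09551 — 5 statements merged into one kernel-verified Lean document; each statement's English description precedes it below -/
import Mathlib

section
/- Let n, ℓ ∈ ℕ. If S = (s_1, …, s_ℓ) is sampled uniformly at random from ({0,1}^n)^ℓ, then the probability that S is not good is at most ℓ⁶/2^n. In particular, with probability at least 1 − ℓ⁶/2^n the elements s_1, …, s_ℓ are pairwise distinct. -/
open scoped BigOperators

/-- The group `{0,1}^n` with bitwise XOR as addition. -/
abbrev BV (n : ℕ) : Type := Fin n → ZMod 2

/-- A tuple `S = (s_1, …, s_ℓ)` of elements of `{0,1}^n` is *good* if for every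
`k ∈ {1,2,3}`, every solution of `s_{i_1} ⊕ ⋯ ⊕ s_{i_{2k}} = 0^n` has every index
appearing with even multiplicity in the index multiset `{i_1, …, i_{2k}}`. -/
def IsGood {n ℓ : ℕ} (S : Fin ℓ → BV n) : Prop :=
  ∀ k ∈ ({1, 2, 3} : Finset ℕ), ∀ i : Fin (2 * k) → Fin ℓ,
    (∑ j, S (i j)) = 0 →
      ∀ a : Fin ℓ, Even ((Finset.univ.filter fun j => i j = a).card)

attribute [local instance] Classical.propDecidable

/-- In `{0,1}^n`, every element is its own inverse. -/
lemma bv_add_self {n : ℕ} (v : BV n) : v + v = 0 := by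
  funext x
  exact CharTwo.add_self_eq_zero (v x)

/-- A tuple that is not good has a bad solution of length six. -/
lemma exists_six {n ℓ : ℕ} (S : Fin ℓ → BV n) (h : ¬ IsGood S) :
    ∃ i : Fin 6 → Fin ℓ, (∑ j, S (i j)) = 0 ∧
      ∃ a, Odd ((Finset.univ.filter fun j => i j = a).card) := by
  unfold IsGood at h
  push Not at h
  obtain ⟨k, hk, i, h0, a, ha⟩ := h
  rw [Nat.not_even_iff_odd] at ha
  have hs : S a + S a = 0 := bv_add_self _
  simp only [Finset.mem_insert, Finset.mem_singleton] at hk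
  rcases hk with rfl | rfl | rfl
  · change Fin 2 → Fin ℓ at i
    change (∑ j : Fin 2, S (i j)) = 0 at h0
    change Odd ((Finset.univ.filter fun j : Fin 2 => i j = a).card) at ha
    refine ⟨![i 0, i 1, a, a, a, a], ?_, a, ?_⟩
    · rw [Fin.sum_univ_two] at h0
      rw [Fin.sum_univ_six]
      change S (i 0) + S (i 1) + S a + S a + S a + S a = 0
      rw [h0, zero_add, hs, zero_add, hs]
    · rw [Finset.card_filter, Fin.sum_univ_two] at ha
      rw [Finset.card_filter, Fin.sum_univ_six]
      change Odd ((if i 0 = a then 1 else 0) + (if i 1 = a then 1 else 0)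
        + (if a = a then 1 else 0) + (if a = a then 1 else 0)
        + (if a = a then 1 else 0) + (if a = a then 1 else 0))
      simp only [if_true]
      obtain ⟨m, hm⟩ := ha
      exact ⟨m + 2, by omega⟩
  · change Fin 4 → Fin ℓ at i
    change (∑ j : Fin 4, S (i j)) = 0 at h0
    change Odd ((Finset.univ.filter fun j : Fin 4 => i j = a).card) at ha
    refine ⟨![i 0, i 1, i 2, i 3, a, a], ?_, a, ?_⟩
    · rw [Fin.sum_univ_four] at h0
      rw [Fin.sum_univ_six]
      change S (i 0) + S (i 1) + S (i 2) + S (i 3) + S a + S a = 0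
      rw [h0, zero_add, hs]
    · rw [Finset.card_filter, Fin.sum_univ_four] at ha
      rw [Finset.card_filter, Fin.sum_univ_six]
      change Odd ((if i 0 = a then 1 else 0) + (if i 1 = a then 1 else 0)
        + (if i 2 = a then 1 else 0) + (if i 3 = a then 1 else 0)
        + (if a = a then 1 else 0) + (if a = a then 1 else 0))
      simp only [if_true]
      obtain ⟨m, hm⟩ := ha
      exact ⟨m + 1, by omega⟩
  · exact ⟨i, h0, a, ha⟩

/-- For a fixed bad index tuple, a `2^{-n}` fraction of tuples `S` solves the equation. -/
lemma card_solutions {n ℓ : ℕ} (i : Fin 6 → Fin ℓ) (a : Fin ℓ)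
    (ha : Odd ((Finset.univ.filter fun j => i j = a).card)) :
    (Finset.univ.filter fun S : Fin ℓ → BV n => (∑ j, S (i j)) = 0).card * 2 ^ n
      ≤ (2 ^ n) ^ ℓ := by
  have key : ∀ v : BV n, (∑ j, (Pi.single a v : Fin ℓ → BV n) (i j)) = v := by
    intro v
    simp only [Pi.single_apply]
    rw [← Finset.sum_filter, Finset.sum_const]
    obtain ⟨m, hm⟩ := ha
    have h2 : ((Finset.univ.filter fun j => i j = a).card) • v = v := by
      rw [hm, add_smul, mul_comm, mul_smul, two_smul, bv_add_self, smul_zero, zero_add, one_smul]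
    convert h2
  have h1 : (Finset.univ : Finset (BV n)).card = 2 ^ n := by
    simp [ZMod.card]
  have h2 : (Finset.univ : Finset (Fin ℓ → BV n)).card = (2 ^ n) ^ ℓ := by
    simp [ZMod.card]
  rw [← h2, ← h1, ← Finset.card_product]
  refine Finset.card_le_card_of_injOn
    (fun p => p.1 + (Pi.single a p.2 : Fin ℓ → BV n)) (fun _ _ => Finset.mem_univ _) ?_
  rintro ⟨S, v⟩ hS ⟨T, w⟩ hT h
  simp only [Finset.coe_product, Set.mem_prod, Finset.mem_coe, Finset.mem_filter,
    Finset.mem_univ, true_and, and_true] at hS hT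
  dsimp only at h
  have hv : v = w := by
    have h3 := congrArg (fun U : Fin ℓ → BV n => ∑ j, U (i j)) h
    simp only [Pi.add_apply, Finset.sum_add_distrib, key] at h3
    rwa [hS, hT, zero_add, zero_add] at h3
  subst hv
  rw [add_right_cancel h]

lemma card_not_good (n ℓ : ℕ) :
    (Finset.univ.filter fun S : Fin ℓ → BV n => ¬ IsGood S).card * 2 ^ n
      ≤ ℓ ^ 6 * (2 ^ n) ^ ℓ := by
  let B : Finset (Fin 6 → Fin ℓ) := Finset.univ.filter fun i =>
    ∃ a, Odd ((Finset.univ.filter fun j => i j = a).card)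
  have hsub : (Finset.univ.filter fun S : Fin ℓ → BV n => ¬ IsGood S) ⊆
      B.biUnion fun i => Finset.univ.filter fun S : Fin ℓ → BV n => (∑ j, S (i j)) = 0 := by
    intro S hS
    obtain ⟨i, h0, h⟩ := exists_six S (Finset.mem_filter.1 hS).2
    exact Finset.mem_biUnion.2 ⟨i, Finset.mem_filter.2 ⟨Finset.mem_univ _, h⟩,
      Finset.mem_filter.2 ⟨Finset.mem_univ _, h0⟩⟩
  have hB : B.card ≤ ℓ ^ 6 := by
    refine (Finset.card_le_univ B).trans ?_
    simp
  calc _ ≤ (∑ i ∈ B, (Finset.univ.filter fun S : Fin ℓ → BV n =>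
            (∑ j, S (i j)) = 0).card) * 2 ^ n :=
        Nat.mul_le_mul_right _ ((Finset.card_le_card hsub).trans Finset.card_biUnion_le)
    _ = ∑ i ∈ B, (Finset.univ.filter fun S : Fin ℓ → BV n =>
            (∑ j, S (i j)) = 0).card * 2 ^ n := Finset.sum_mul _ _ _
    _ ≤ ∑ i ∈ B, (2 ^ n) ^ ℓ := by
        refine Finset.sum_le_sum fun i hi => ?_
        obtain ⟨a, ha⟩ := (Finset.mem_filter.1 hi).2
        exact card_solutions i a ha
    _ = B.card * (2 ^ n) ^ ℓ := by rw [Finset.sum_const, smul_eq_mul]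
    _ ≤ _ := Nat.mul_le_mul_right _ hB

lemma good_injective {n ℓ : ℕ} (S : Fin ℓ → BV n) (h : IsGood S) : Function.Injective S := by
  intro a b hab
  by_contra hne
  have h1 := h 1 (by simp) (![a, b] : Fin 2 → Fin ℓ)
    (by
      change (∑ j : Fin 2, S ((![a, b] : Fin 2 → Fin ℓ) j)) = 0
      rw [Fin.sum_univ_two]
      change S a + S b = 0
      rw [hab, bv_add_self]) a
  change Even ((Finset.univ.filter fun j : Fin 2 => (![a, b] : Fin 2 → Fin ℓ) j = a).card) at h1
  rw [Finset.card_filter, Fin.sum_univ_two] at h1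
  change Even ((if a = a then 1 else 0) + (if b = a then 1 else 0)) at h1
  rw [if_pos rfl, if_neg (Ne.symm hne)] at h1
  exact absurd h1 (by decide)

/-- If `S = (s_1, …, s_ℓ)` is sampled uniformly from `({0,1}^n)^ℓ`, the
probability that `S` is not good is at most `ℓ⁶/2^n`; in particular, with probability at
least `1 − ℓ⁶/2^n` the elements `s_1, …, s_ℓ` are pairwise distinct. -/
theorem random_tuple_is_good (n ℓ : ℕ) :
    ((Finset.univ.filter fun S : Fin ℓ → BV n => ¬ IsGood S).card : ℝ) / ((2 : ℝ) ^ n) ^ ℓ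
        ≤ (ℓ : ℝ) ^ 6 / 2 ^ n ∧
    1 - (ℓ : ℝ) ^ 6 / 2 ^ n ≤
      ((Finset.univ.filter fun S : Fin ℓ → BV n => Function.Injective S).card : ℝ)
        / ((2 : ℝ) ^ n) ^ ℓ := by
  have hN : (0 : ℝ) < ((2 : ℝ) ^ n) ^ ℓ := by positivity
  have h2 : (0 : ℝ) < (2 : ℝ) ^ n := by positivity
  have h1 : ((Finset.univ.filter fun S : Fin ℓ → BV n => ¬ IsGood S).card : ℝ)
      / ((2 : ℝ) ^ n) ^ ℓ ≤ (ℓ : ℝ) ^ 6 / 2 ^ n := by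
    rw [div_le_div_iff₀ hN h2]
    exact_mod_cast card_not_good n ℓ
  refine ⟨h1, ?_⟩
  have h3 : (2 ^ n) ^ ℓ ≤ (Finset.univ.filter fun S : Fin ℓ → BV n => Function.Injective S).card
      + (Finset.univ.filter fun S : Fin ℓ → BV n => ¬ IsGood S).card := by
    have hu : (Finset.univ : Finset (Fin ℓ → BV n)).card = (2 ^ n) ^ ℓ := by
      simp [ZMod.card]
    rw [← hu]
    refine (Finset.card_le_card ?_).trans (Finset.card_union_le _ _)
    intro S _
    by_cases hS : IsGood S
    · exact Finset.mem_union_left _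
        (Finset.mem_filter.2 ⟨Finset.mem_univ _, good_injective S hS⟩)
    · exact Finset.mem_union_right _ (Finset.mem_filter.2 ⟨Finset.mem_univ _, hS⟩)
  have h4 : ((2 : ℝ) ^ n) ^ ℓ ≤
      ((Finset.univ.filter fun S : Fin ℓ → BV n => Function.Injective S).card : ℝ)
      + ((Finset.univ.filter fun S : Fin ℓ → BV n => ¬ IsGood S).card : ℝ) := by
    exact_mod_cast h3
  have h5 := (div_le_div_iff_of_pos_right hN).2 h4
  rw [div_self hN.ne', add_div] at h5
  linarith
end

section
/- Fix n, ℓ ∈ ℕ, κ ∈ [0,1], ρ > 0, and a multiset S = {s_1,…,s_ℓ} of size ℓ over {0,1}^n. Sample the random set U ⊆ {0,1}^n by including each y ∈ {0,1}^n independently with probability 1 − e^{−κ γ_y^{(S)}}/2. Then Pr_U[ max_{x,x' ∈ S} |M^S_{x,x'} − M^{S,U}_{x,x'}| > ρ ] ≤ 2ℓ² e^{−ρ² 2^n / 2}. -/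
open scoped BigOperators

attribute [local instance] Classical.propDecidable

/-- The sign `(−1)^{x·y}` where `x·y` is the mod-2 inner product. -/
noncomputable def chiR {n : ℕ} (x y : BV n) : ℝ :=
  if (∑ j, x j * y j : ZMod 2) = 0 then 1 else -1

/-- `γ_y^{(S)} = ((1/√ℓ) ∑_i (−1)^{y·s_i})²` for the multiset `S = {s_1,…,s_ℓ}`. -/
noncomputable def gammaS {n ℓ : ℕ} (S : Fin ℓ → BV n) (y : BV n) : ℝ :=
  ((Real.sqrt ℓ)⁻¹ * ∑ i, chiR y (S i)) ^ 2

/-- The inclusion probability `1 − e^{−κ γ_y^{(S)}}/2` of `y` in `U`. -/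
noncomputable def pInc {n ℓ : ℕ} (κ : ℝ) (S : Fin ℓ → BV n) (y : BV n) : ℝ :=
  1 - Real.exp (-(κ * gammaS S y)) / 2

/-- The probability of obtaining the set `U` when each `y` is included independently
with probability `pInc κ S y`. -/
noncomputable def wgt {n ℓ : ℕ} (κ : ℝ) (S : Fin ℓ → BV n) (U : Finset (BV n)) : ℝ :=
  ∏ y : BV n, if y ∈ U then pInc κ S y else 1 - pInc κ S y

/-- The Hadamard matrix `H^{⊗n}` with entries `2^{−n/2} (−1)^{x·y}`. -/
noncomputable def Had (n : ℕ) : Matrix (BV n) (BV n) ℝ :=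
  Matrix.of fun x y => (Real.sqrt ((2 : ℝ) ^ n))⁻¹ * chiR x y

/-- The diagonal projection `Π_T = ∑_{x∈T} |x⟩⟨x|`. -/
noncomputable def projM {n : ℕ} (T : Finset (BV n)) : Matrix (BV n) (BV n) ℝ :=
  Matrix.of fun x y => if x = y ∧ x ∈ T then 1 else 0

/-- The set of distinct elements of the multiset `S`. -/
noncomputable def distinctS {n ℓ : ℕ} (S : Fin ℓ → BV n) : Finset (BV n) :=
  Finset.image S Finset.univ

/-- `M^{S,U} = Π_S · H^{⊗n} · Π_U · H^{⊗n} · Π_S`. -/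
noncomputable def MSU {n ℓ : ℕ} (S : Fin ℓ → BV n) (U : Finset (BV n)) :
    Matrix (BV n) (BV n) ℝ :=
  projM (distinctS S) * Had n * projM U * Had n * projM (distinctS S)

/-- `M^S = E_U[M^{S,U}]`, the entrywise expectation over the random set `U` given `S`. -/
noncomputable def MS {n ℓ : ℕ} (κ : ℝ) (S : Fin ℓ → BV n) : Matrix (BV n) (BV n) ℝ :=
  Matrix.of fun x x' => ∑ U : Finset (BV n), wgt κ S U * MSU S U x x'

/-- The operator (spectral) norm of a real matrix. -/
noncomputable def opN {m : Type*} [Fintype m] [DecidableEq m] (A : Matrix m m ℝ) : ℝ :=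
  ‖LinearMap.toContinuousLinearMap (Matrix.toEuclideanLin A)‖

/-- The principal submatrix of `A` with rows and columns in `Δ`. -/
noncomputable def subM {n : ℕ} (A : Matrix (BV n) (BV n) ℝ) (Δ : Finset (BV n)) :
    Matrix {x // x ∈ Δ} {x // x ∈ Δ} ℝ :=
  A.submatrix (fun a => (a : BV n)) (fun a => (a : BV n))

section aux
variable {V : Type} [Fintype V]

/-- product weight -/
noncomputable def pw (a b : V → ℝ) (U : Finset V) : ℝ :=
  ∏ y : V, if y ∈ U then a y else b y

lemma sum_pw (a b : V → ℝ) : ∑ U : Finset V, pw a b U = ∏ y, (a y + b y) := by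
  rw [Fintype.prod_add]
  refine Finset.sum_congr rfl fun U _ => ?_
  unfold pw
  rw [Finset.prod_ite]
  congr 1
  · refine Finset.prod_congr ?_ fun _ _ => rfl
    ext y; simp
  · refine Finset.prod_congr ?_ fun _ _ => rfl
    ext y; simp

lemma sum_pw_ind (p : V → ℝ) (y : V) :
    ∑ U : Finset V, pw p (fun z => 1 - p z) U * (if y ∈ U then 1 else 0) = p y := by
  have h : ∀ U : Finset V, pw p (fun z => 1 - p z) U * (if y ∈ U then 1 else 0)
      = pw p (fun z => if z = y then 0 else 1 - p z) U := by
    intro U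
    by_cases hy : y ∈ U
    · rw [if_pos hy, mul_one]
      unfold pw
      refine Finset.prod_congr rfl fun z _ => ?_
      by_cases hz : z ∈ U
      · simp [hz]
      · have : z ≠ y := fun h => hz (h ▸ hy)
        simp [hz, this]
    · rw [if_neg hy, mul_zero]
      unfold pw
      symm
      apply Finset.prod_eq_zero (Finset.mem_univ y)
      simp [hy]
  rw [Finset.sum_congr rfl fun U _ => h U, sum_pw]
  rw [Finset.prod_eq_single y]
  · simp
  · intro z _ hz
    simp [hz]
  · simp

lemma exp_chord (t x : ℝ) (h1 : -1 ≤ x) (h2 : x ≤ 1) :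
    Real.exp (t * x) ≤ Real.cosh t + x * Real.sinh t := by
  have := convexOn_exp.2 (Set.mem_univ t) (Set.mem_univ (-t))
    (show (0:ℝ) ≤ (1 + x) / 2 by linarith) (show (0:ℝ) ≤ (1 - x) / 2 by linarith) (by ring)
  simp only [smul_eq_mul] at this
  rw [Real.cosh_eq, Real.sinh_eq]
  calc _ = Real.exp ((1 + x) / 2 * t + (1 - x) / 2 * -t) := by congr 1; ring
    _ ≤ _ := this
    _ = _ := by ring

lemma bern_mgf (t p : ℝ) (h0 : 0 ≤ p) (h1 : p ≤ 1) :
    p * Real.exp (t * (1 - p)) + (1 - p) * Real.exp (t * (-p)) ≤ Real.exp (t ^ 2 / 2) := by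
  have a := exp_chord t (1 - p) (by linarith) (by linarith)
  have b := exp_chord t (-p) (by linarith) (by linarith)
  have c := Real.cosh_le_exp_half_sq t
  have a' := mul_le_mul_of_nonneg_left a h0
  have b' := mul_le_mul_of_nonneg_left b (sub_nonneg.2 h1)
  nlinarith

/-- linear statistic -/
noncomputable def lin (c : V → ℝ) (U : Finset V) : ℝ := ∑ y, c y * (if y ∈ U then 1 else 0)

lemma mean_lin (p c : V → ℝ) :
    ∑ U : Finset V, pw p (fun z => 1 - p z) U * lin c U = ∑ y, c y * p y := by
  unfold lin
  simp_rw [Finset.mul_sum]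
  rw [Finset.sum_comm]
  refine Finset.sum_congr rfl fun y _ => ?_
  rw [← sum_pw_ind p y, Finset.mul_sum]
  refine Finset.sum_congr rfl fun U _ => ?_
  ring

lemma mgf_lin (p c : V → ℝ) (h0 : ∀ y, 0 ≤ p y) (h1 : ∀ y, p y ≤ 1) (t : ℝ) :
    ∑ U : Finset V, pw p (fun z => 1 - p z) U * Real.exp (t * (lin c U - ∑ y, c y * p y))
      ≤ Real.exp (t ^ 2 * (∑ y, c y ^ 2) / 2) := by
  have h : ∀ U : Finset V,
      pw p (fun z => 1 - p z) U * Real.exp (t * (lin c U - ∑ y, c y * p y))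
      = pw (fun y => p y * Real.exp (t * c y * (1 - p y)))
          (fun y => (1 - p y) * Real.exp (t * c y * (-p y))) U := by
    intro U
    unfold pw lin
    rw [← Finset.sum_sub_distrib, Finset.mul_sum, Real.exp_sum, ← Finset.prod_mul_distrib]
    refine Finset.prod_congr rfl fun y _ => ?_
    by_cases hy : y ∈ U
    · simp only [hy, if_true]
      congr 2; ring
    · simp only [hy, if_false]
      congr 2; ring
  rw [Finset.sum_congr rfl fun U _ => h U, sum_pw, Finset.mul_sum, Finset.sum_div, Real.exp_sum]
  refine Finset.prod_le_prod (fun y _ => ?_) fun y _ => ?_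
  · have := h0 y
    have := sub_nonneg.2 (h1 y)
    positivity
  · have := bern_mgf (t * c y) (p y) (h0 y) (h1 y)
    rwa [mul_pow] at this

lemma pw_nonneg (p : V → ℝ) (h0 : ∀ y, 0 ≤ p y) (h1 : ∀ y, p y ≤ 1) (U : Finset V) :
    0 ≤ pw p (fun z => 1 - p z) U := by
  unfold pw
  refine Finset.prod_nonneg fun y _ => ?_
  split_ifs
  · exact h0 y
  · exact sub_nonneg.2 (h1 y)

lemma tail_lin (p c : V → ℝ) (h0 : ∀ y, 0 ≤ p y) (h1 : ∀ y, p y ≤ 1) (ρ N : ℝ)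
    (hρ : 0 < ρ) (hN : 0 < N) (hc : ∑ y, c y ^ 2 = N⁻¹) :
    ∑ U : Finset V, (if ρ < lin c U - ∑ y, c y * p y then pw p (fun z => 1 - p z) U else 0)
      ≤ Real.exp (-(ρ ^ 2 * N / 2)) := by
  have hm := mgf_lin p c h0 h1 (ρ * N)
  have : ∑ U : Finset V,
        (if ρ < lin c U - ∑ y, c y * p y then pw p (fun z => 1 - p z) U else 0)
      ≤ Real.exp (-(ρ * N * ρ)) * ∑ U : Finset V, pw p (fun z => 1 - p z) U *
        Real.exp (ρ * N * (lin c U - ∑ y, c y * p y)) := by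
    rw [Finset.mul_sum]
    refine Finset.sum_le_sum fun U _ => ?_
    have hw := pw_nonneg p h0 h1 U
    split_ifs with h
    · rw [mul_left_comm, ← Real.exp_add]
      refine le_mul_of_one_le_right hw (Real.one_le_exp ?_)
      have : 0 < ρ * N := by positivity
      nlinarith
    · positivity
  refine this.trans ((mul_le_mul_of_nonneg_left hm (Real.exp_pos _).le).trans ?_)
  rw [← Real.exp_add, hc]
  apply Real.exp_le_exp.2
  apply le_of_eq
  field_simp
  ring

lemma tail_abs (p c : V → ℝ) (h0 : ∀ y, 0 ≤ p y) (h1 : ∀ y, p y ≤ 1) (ρ N : ℝ)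
    (hρ : 0 < ρ) (hN : 0 < N) (hc : ∑ y, c y ^ 2 = N⁻¹) :
    ∑ U : Finset V, (if ρ < |(∑ y, c y * p y) - lin c U| then pw p (fun z => 1 - p z) U else 0)
      ≤ 2 * Real.exp (-(ρ ^ 2 * N / 2)) := by
  have A := tail_lin p c h0 h1 ρ N hρ hN hc
  have B := tail_lin p (fun y => - c y) h0 h1 ρ N hρ hN (by simpa using hc)
  rw [two_mul]
  refine le_trans ?_ (add_le_add A B)
  rw [← Finset.sum_add_distrib]
  refine Finset.sum_le_sum fun U _ => ?_
  have hw := pw_nonneg p h0 h1 U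
  have e1 : lin (fun y => - c y) U = - lin c U := by simp [lin]
  have e2 : ∑ y, -c y * p y = - ∑ y, c y * p y := by simp
  rw [e1, e2]
  split_ifs with h h2 h3 h3 <;> first | linarith | skip
  exfalso
  rcases lt_abs.1 h with h | h <;> linarith

end aux

lemma chiR_sq {n : ℕ} (x y : BV n) : chiR x y ^ 2 = 1 := by
  unfold chiR; split_ifs <;> norm_num

lemma MSU_apply {n ℓ : ℕ} (S : Fin ℓ → BV n) (U : Finset (BV n)) (x x' : BV n)
    (hx : x ∈ distinctS S) (hx' : x' ∈ distinctS S) :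
    MSU S U x x' = lin (fun y => ((2:ℝ) ^ n)⁻¹ * (chiR x y * chiR y x')) U := by
  have hp : ∀ T : Finset (BV n), projM T = Matrix.diagonal (fun y => if y ∈ T then (1:ℝ) else 0) := by
    intro T
    ext a b
    by_cases h : a = b
    · subst h; simp [projM]
    · simp [projM, h]
  unfold MSU
  rw [hp, hp, Matrix.mul_diagonal, Matrix.mul_apply, if_pos hx', mul_one]
  unfold lin
  refine Finset.sum_congr rfl fun y _ => ?_
  rw [Matrix.mul_diagonal, Matrix.diagonal_mul, if_pos hx, one_mul]
  simp only [Had, Matrix.of_apply]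
  have : (Real.sqrt ((2:ℝ) ^ n))⁻¹ * (Real.sqrt ((2:ℝ) ^ n))⁻¹ = ((2:ℝ) ^ n)⁻¹ := by
    rw [← mul_inv, Real.mul_self_sqrt (by positivity)]
  rw [← this]
  ring

/-- entrywise concentration of `M^{S,U}` around `M^S`.
For the random set `U` (each `y` included independently with probability
`1 − e^{−κγ_y^{(S)}}/2`),
`Pr_U[max_{x,x'∈S} |M^S_{x,x'} − M^{S,U}_{x,x'}| > ρ] ≤ 2ℓ² e^{−ρ²2^n/2}`. -/
theorem entrywise_concentration (n ℓ : ℕ) (κ ρ : ℝ) (hκ0 : 0 ≤ κ) (hκ1 : κ ≤ 1)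
    (hρ : 0 < ρ) (S : Fin ℓ → BV n) :
    (∑ U : Finset (BV n),
        if ∃ x ∈ distinctS S, ∃ x' ∈ distinctS S, ρ < |MS κ S x x' - MSU S U x x'|
        then wgt κ S U else 0)
      ≤ 2 * (ℓ : ℝ) ^ 2 * Real.exp (-(ρ ^ 2 * 2 ^ n / 2)) := by
  classical
  have hp0 : ∀ y, 0 ≤ pInc κ S y := by
    intro y
    have : Real.exp (-(κ * gammaS S y)) ≤ 1 := by
      apply Real.exp_le_one_iff.2
      have : 0 ≤ gammaS S y := sq_nonneg _
      have := mul_nonneg hκ0 this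
      linarith
    unfold pInc; linarith
  have hp1 : ∀ y, pInc κ S y ≤ 1 := by
    intro y
    have := Real.exp_pos (-(κ * gammaS S y))
    unfold pInc; linarith
  have hw : ∀ U, wgt κ S U = pw (pInc κ S) (fun z => 1 - pInc κ S z) U := by
    intro U
    unfold wgt pw
    refine Finset.prod_congr rfl fun y _ => ?_
    by_cases h : y ∈ U <;> simp [h]
  have key : ∀ x ∈ distinctS S, ∀ x' ∈ distinctS S,
      ∑ U : Finset (BV n), (if ρ < |MS κ S x x' - MSU S U x x'| then wgt κ S U else 0)
        ≤ 2 * Real.exp (-(ρ ^ 2 * 2 ^ n / 2)) := by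
    intro x hx x' hx'
    have := tail_abs (pInc κ S) (fun y => ((2:ℝ) ^ n)⁻¹ * (chiR x y * chiR y x')) hp0 hp1 ρ (2 ^ n)
      hρ (by positivity) (by
        simp only [mul_pow, chiR_sq, mul_one, Finset.sum_const, Finset.card_univ]
        simp [sq])
    rw [← mean_lin] at this
    have hM : MS κ S x x' = ∑ U : Finset (BV n), wgt κ S U *
        lin (fun y => ((2:ℝ) ^ n)⁻¹ * (chiR x y * chiR y x')) U := by
      simp only [MS, Matrix.of_apply]
      exact Finset.sum_congr rfl fun U _ => by rw [MSU_apply S U x x' hx hx']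
    rw [hM]
    simp_rw [MSU_apply S _ x x' hx hx', hw]
    exact this
  have hcard : ((distinctS S).card : ℝ) ≤ ℓ := by
    have : (distinctS S).card ≤ ℓ := by
      unfold distinctS
      exact Finset.card_image_le.trans (by simp)
    exact_mod_cast this
  have hwn : ∀ U, 0 ≤ wgt κ S U := fun U => by rw [hw]; exact pw_nonneg _ hp0 hp1 U
  calc _ ≤ ∑ U : Finset (BV n), ∑ x ∈ distinctS S, ∑ x' ∈ distinctS S,
        (if ρ < |MS κ S x x' - MSU S U x x'| then wgt κ S U else 0) := by
        refine Finset.sum_le_sum fun U _ => ?_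
        have hnn : ∀ x x', 0 ≤ (if ρ < |MS κ S x x' - MSU S U x x'| then wgt κ S U else 0) := by
          intro x x'
          split_ifs
          · exact hwn U
          · exact le_rfl
        split_ifs with h
        · obtain ⟨x, hx, x', hx', h⟩ := h
          calc wgt κ S U = (if ρ < |MS κ S x x' - MSU S U x x'| then wgt κ S U else 0) := by
                rw [if_pos h]
            _ ≤ ∑ x' ∈ distinctS S,
                (if ρ < |MS κ S x x' - MSU S U x x'| then wgt κ S U else 0) :=
                Finset.single_le_sum (f := fun x' =>
                  (if ρ < |MS κ S x x' - MSU S U x x'| then wgt κ S U else 0))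
                  (fun z _ => hnn x z) hx'
            _ ≤ _ := Finset.single_le_sum (f := fun x => ∑ x' ∈ distinctS S,
                  (if ρ < |MS κ S x x' - MSU S U x x'| then wgt κ S U else 0))
                  (fun z _ => Finset.sum_nonneg fun z' _ => hnn z z') hx
        · exact Finset.sum_nonneg fun x _ => Finset.sum_nonneg fun x' _ => hnn x x'
    _ = ∑ x ∈ distinctS S, ∑ x' ∈ distinctS S, ∑ U : Finset (BV n),
        (if ρ < |MS κ S x x' - MSU S U x x'| then wgt κ S U else 0) := by
        rw [Finset.sum_comm]
        exact Finset.sum_congr rfl fun x _ => Finset.sum_comm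
    _ ≤ ∑ x ∈ distinctS S, ∑ x' ∈ distinctS S, 2 * Real.exp (-(ρ ^ 2 * 2 ^ n / 2)) :=
        Finset.sum_le_sum fun x hx => Finset.sum_le_sum fun x' hx' => key x hx x' hx'
    _ = 2 * ((distinctS S).card : ℝ) ^ 2 * Real.exp (-(ρ ^ 2 * 2 ^ n / 2)) := by
        simp only [Finset.sum_const, nsmul_eq_mul]
        ring
    _ ≤ _ := by gcongr
end

section
/- Fix n, ℓ ∈ ℕ, κ ∈ [0,1], ρ > 0, and a multiset S of size ℓ over {0,1}^n. Sample the random set U ⊆ {0,1}^n by including each y ∈ {0,1}^n independently with probability 1 − e^{−κ γ_y^{(S)}}/2. Then, except with probability at most 2ℓ² e^{−ρ² 2^n/(2ℓ²)} over U, both of the following hold: ‖M^{S,U}‖_op ≥ ‖M^S‖_op − ρ, and for every subset Δ of the distinct elements of S, ‖M^{S,U}_{[Δ]}‖_op ≤ ‖M^S_{[Δ]}‖_op + ρ. -/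
open scoped BigOperators

attribute [local instance] Classical.propDecidable

lemma aux_bern (p c t : ℝ) (h0 : 0 ≤ p) (h1 : p ≤ 1) (hc : |c| ≤ 1) :
    p * Real.exp (t * ((1 - p) * c)) + (1 - p) * Real.exp (t * ((0 - p) * c))
      ≤ Real.exp (t ^ 2 / 2) := by
  have hz1 : |(1 - p) * c| ≤ 1 := by
    rw [abs_mul, abs_of_nonneg (by linarith : 0 ≤ 1 - p)]
    nlinarith [abs_nonneg c]
  have hz2 : |(0 - p) * c| ≤ 1 := by
    rw [abs_mul, zero_sub, abs_neg, abs_of_nonneg h0]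
    nlinarith [abs_nonneg c]
  have a1 := Real.exp_mul_le_cosh_add_mul_sinh hz1 t
  have a2 := Real.exp_mul_le_cosh_add_mul_sinh hz2 t
  have a3 := Real.cosh_le_exp_half_sq t
  have b1 := mul_le_mul_of_nonneg_left a1 h0
  have b2 := mul_le_mul_of_nonneg_left a2 (by linarith : 0 ≤ 1 - p)
  rw [mul_comm t, mul_comm t]
  nlinarith

lemma aux_prod {α : Type*} [Fintype α] [DecidableEq α] (p : α → ℝ) (a b : α → ℝ) :
    ∑ U : Finset α, (∏ y, if y ∈ U then p y else 1 - p y) * ∏ y, (if y ∈ U then a y else b y)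
      = ∏ y, (p y * a y + (1 - p y) * b y) := by
  rw [Finset.prod_add, Finset.powerset_univ]
  refine Finset.sum_congr rfl fun U _ => ?_
  rw [← Finset.prod_mul_distrib, ← Finset.prod_sdiff (Finset.subset_univ U), mul_comm]
  congr 1
  · exact Finset.prod_congr rfl fun y hy => by simp [hy]
  · exact Finset.prod_congr rfl fun y hy => by simp [(Finset.mem_sdiff.1 hy).2]

lemma aux_mgf {α : Type*} [Fintype α] [DecidableEq α] (p c : α → ℝ) (t : ℝ)
    (h0 : ∀ y, 0 ≤ p y) (h1 : ∀ y, p y ≤ 1) (hc : ∀ y, |c y| ≤ 1) :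
    ∑ U : Finset α, (∏ y, if y ∈ U then p y else 1 - p y) *
      Real.exp (t * ∑ y, ((if y ∈ U then 1 else 0) - p y) * c y)
      ≤ Real.exp (Fintype.card α * (t ^ 2 / 2)) := by
  have e : ∀ U : Finset α, Real.exp (t * ∑ y, ((if y ∈ U then 1 else 0) - p y) * c y)
      = ∏ y, if y ∈ U then Real.exp (t * ((1 - p y) * c y))
          else Real.exp (t * ((0 - p y) * c y)) := by
    intro U
    rw [Finset.mul_sum, Real.exp_sum]
    refine Finset.prod_congr rfl fun y _ => ?_
    split_ifs <;> rfl
  simp_rw [e]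
  rw [aux_prod]
  calc _ ≤ ∏ y : α, Real.exp (t ^ 2 / 2) := by
        refine Finset.prod_le_prod (fun y _ => ?_) fun y _ => aux_bern _ _ _ (h0 y) (h1 y) (hc y)
        have := h0 y
        have := sub_nonneg.2 (h1 y)
        positivity
    _ = _ := by rw [Finset.prod_const, ← Real.exp_nat_mul]; rfl

lemma aux_tail {α : Type*} [Fintype α] [DecidableEq α] (p c : α → ℝ) (t : ℝ) (ht : 0 ≤ t)
    (h0 : ∀ y, 0 ≤ p y) (h1 : ∀ y, p y ≤ 1) (hc : ∀ y, |c y| ≤ 1) :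
    (∑ U : Finset α, if Fintype.card α * t < |∑ y, ((if y ∈ U then 1 else 0) - p y) * c y|
      then (∏ y, if y ∈ U then p y else 1 - p y) else 0)
      ≤ 2 * Real.exp (-(Fintype.card α * (t ^ 2 / 2))) := by
  set N : ℝ := (Fintype.card α : ℝ)
  have hw : ∀ U : Finset α, 0 ≤ ∏ y, if y ∈ U then p y else 1 - p y := fun U =>
    Finset.prod_nonneg fun y _ => by
      have := h0 y
      have := h1 y
      split_ifs <;> linarith
  have m1 := aux_mgf p c t h0 h1 hc
  have m2 := aux_mgf p c (-t) h0 h1 hc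
  calc _ ≤ ∑ U : Finset α, Real.exp (-(N * t ^ 2)) *
        ((∏ y, if y ∈ U then p y else 1 - p y) *
          Real.exp (t * ∑ y, ((if y ∈ U then 1 else 0) - p y) * c y) +
        (∏ y, if y ∈ U then p y else 1 - p y) *
          Real.exp (-t * ∑ y, ((if y ∈ U then 1 else 0) - p y) * c y)) := by
        refine Finset.sum_le_sum fun U _ => ?_
        have hU := hw U
        set w := ∏ y, if y ∈ U then p y else 1 - p y
        set g := ∑ y, ((if y ∈ U then 1 else 0) - p y) * c y
        split_ifs with h
        · have key : 1 ≤ Real.exp (-(N * t ^ 2)) * (Real.exp (t * g) + Real.exp (-t * g)) := by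
            rw [mul_add, ← Real.exp_add, ← Real.exp_add]
            rcases lt_abs.1 h with h | h
            · have : 1 ≤ Real.exp (-(N * t ^ 2) + t * g) := Real.one_le_exp (by nlinarith)
              linarith [Real.exp_pos (-(N * t ^ 2) + -t * g)]
            · have : 1 ≤ Real.exp (-(N * t ^ 2) + -t * g) := Real.one_le_exp (by nlinarith)
              linarith [Real.exp_pos (-(N * t ^ 2) + t * g)]
          nlinarith
        · positivity
    _ ≤ Real.exp (-(N * t ^ 2)) * (Real.exp (N * (t ^ 2 / 2)) + Real.exp (N * (t ^ 2 / 2))) := by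
        rw [← Finset.mul_sum, Finset.sum_add_distrib]
        rw [neg_sq] at m2
        gcongr
    _ = _ := by
        rw [← two_mul, mul_left_comm, ← Real.exp_add]
        congr 2; ring

lemma aux_mean {α : Type*} [Fintype α] [DecidableEq α] (p : α → ℝ) (z : α) :
    ∑ U : Finset α, (∏ y, if y ∈ U then p y else 1 - p y) * (if z ∈ U then 1 else 0) = p z := by
  have := aux_prod p (fun _ => 1) (fun y => if y = z then 0 else 1)
  have e : ∏ y, (p y * 1 + (1 - p y) * (if y = z then 0 else 1)) = p z := by
    rw [Finset.prod_eq_single z]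
    · simp
    · intro b _ hb; simp [hb]
    · simp
  rw [e] at this
  rw [← this]
  refine Finset.sum_congr rfl fun U _ => ?_
  congr 1
  split_ifs with h
  · refine (Finset.prod_eq_one fun y _ => ?_).symm
    split_ifs with h1 h2
    · rfl
    · subst h2; exact absurd h h1
    · rfl
  · exact (Finset.prod_eq_zero (Finset.mem_univ z) (by simp [h])).symm

lemma aux_one {α : Type*} [Fintype α] [DecidableEq α] (p : α → ℝ) :
    ∑ U : Finset α, (∏ y, if y ∈ U then p y else 1 - p y) = 1 := by
  have := aux_prod p (fun _ => 1) (fun _ => 1)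
  simpa using this

lemma aux_opN {m : Type*} [Fintype m] [DecidableEq m] (A : Matrix m m ℝ) (T : Finset m)
    (ℓ : ℕ) (ρ : ℝ) (hρ : 0 < ρ) (hT : T.card ≤ ℓ) (h0 : ∀ x y, ¬ (x ∈ T ∧ y ∈ T) → A x y = 0)
    (hA : ∀ x ∈ T, ∀ y ∈ T, |A x y| ≤ ρ / ℓ) : opN A ≤ ρ := by
  refine ContinuousLinearMap.opNorm_le_bound _ hρ.le fun v => ?_
  refine abs_le_of_sq_le_sq' ?_ (by positivity) |>.2
  rw [mul_pow, EuclideanSpace.real_norm_sq_eq, EuclideanSpace.real_norm_sq_eq]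
  have hv : 0 ≤ ∑ i, v i ^ 2 := Finset.sum_nonneg fun i _ => sq_nonneg _
  have hrow : ∀ x ∈ T, ∑ y, A x y ^ 2 ≤ ℓ * (ρ / ℓ) ^ 2 := by
    intro x hx
    rw [← Finset.sum_subset (Finset.subset_univ T)
      (fun y _ hy => by rw [h0 x y (fun h => hy h.2)]; simp)]
    calc _ ≤ ∑ y ∈ T, (ρ / ℓ) ^ 2 :=
          Finset.sum_le_sum fun y hy => sq_le_sq' (abs_le.1 (hA x hx y hy)).1
            (abs_le.1 (hA x hx y hy)).2
      _ = T.card * (ρ / ℓ) ^ 2 := by simp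
      _ ≤ _ := by gcongr
  have hx : ∀ x, (LinearMap.toContinuousLinearMap (Matrix.toEuclideanLin A) v) x
      = ∑ y, A x y * v y := fun x => rfl
  simp_rw [hx]
  rw [← Finset.sum_subset (Finset.subset_univ T)
      (fun x _ hx => by
        rw [Finset.sum_eq_zero, zero_pow two_ne_zero]
        intro y _
        rw [h0 x y (fun h => hx h.1), zero_mul])]
  calc _ ≤ ∑ x ∈ T, (ℓ * (ρ / ℓ) ^ 2) * ∑ i, v i ^ 2 := by
        refine Finset.sum_le_sum fun x hx => ?_
        refine (Finset.sum_mul_sq_le_sq_mul_sq _ _ _).trans ?_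
        exact mul_le_mul_of_nonneg_right (hrow x hx) hv
    _ = T.card * (ℓ * (ρ / ℓ) ^ 2) * ∑ i, v i ^ 2 := by simp [mul_assoc]
    _ ≤ ℓ * (ℓ * (ρ / ℓ) ^ 2) * ∑ i, v i ^ 2 := by gcongr
    _ ≤ _ := by
        refine mul_le_mul_of_nonneg_right ?_ hv
        rcases Nat.eq_zero_or_pos ℓ with rfl | hl
        · simp; positivity
        · have : (ℓ : ℝ) ≠ 0 := by positivity
          apply le_of_eq; field_simp

lemma aux_sub {m : Type*} [Fintype m] [DecidableEq m] (A B : Matrix m m ℝ) :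
    opN A ≤ opN B + opN (A - B) := by
  unfold opN
  have : LinearMap.toContinuousLinearMap (Matrix.toEuclideanLin A)
      = LinearMap.toContinuousLinearMap (Matrix.toEuclideanLin B)
        + LinearMap.toContinuousLinearMap (Matrix.toEuclideanLin (A - B)) := by
    rw [← map_add, ← map_add]; simp
  rw [this]
  exact norm_add_le _ _

lemma aux_entry {n ℓ : ℕ} (S : Fin ℓ → BV n) (U : Finset (BV n)) (x x' : BV n) :
    MSU S U x x' = if x ∈ distinctS S ∧ x' ∈ distinctS S then
      ((2 : ℝ) ^ n)⁻¹ * ∑ y, (if y ∈ U then 1 else 0) * (chiR x y * chiR y x') else 0 := by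
  have hp : ∀ T : Finset (BV n), projM T = Matrix.diagonal fun x => if x ∈ T then (1:ℝ) else 0 := by
    intro T
    ext a b
    by_cases h : a = b
    · subst h; simp [projM]
    · simp [projM, h]
  have hs : (Real.sqrt ((2 : ℝ) ^ n))⁻¹ * (Real.sqrt ((2 : ℝ) ^ n))⁻¹ = ((2 : ℝ) ^ n)⁻¹ := by
    rw [← mul_inv, Real.mul_self_sqrt (by positivity)]
  unfold MSU
  rw [hp, hp, Matrix.mul_diagonal, Matrix.mul_apply]
  simp only [Matrix.mul_diagonal, Matrix.diagonal_mul]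
  by_cases h1 : x ∈ distinctS S <;> by_cases h2 : x' ∈ distinctS S <;> simp only [h1, h2]
  · simp only [if_true, and_self, one_mul, mul_one]
    rw [← hs, Finset.mul_sum]
    refine Finset.sum_congr rfl fun y _ => ?_
    simp only [Had, Matrix.of_apply]
    ring
  all_goals simp

lemma aux_chi {n : ℕ} (x y : BV n) : |chiR x y| = 1 := by
  unfold chiR; split_ifs <;> simp

lemma aux_p {n ℓ : ℕ} (κ : ℝ) (hκ0 : 0 ≤ κ) (S : Fin ℓ → BV n) (y : BV n) :
    0 ≤ pInc κ S y ∧ pInc κ S y ≤ 1 := by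
  have h : 0 ≤ gammaS S y := sq_nonneg _
  have h1 : Real.exp (-(κ * gammaS S y)) ≤ 1 :=
    Real.exp_le_one_iff.2 (by have := mul_nonneg hκ0 h; linarith)
  have h2 := Real.exp_pos (-(κ * gammaS S y))
  unfold pInc
  constructor <;> linarith

lemma aux_MS {n ℓ : ℕ} (κ : ℝ) (S : Fin ℓ → BV n) (x x' : BV n) :
    MS κ S x x' = if x ∈ distinctS S ∧ x' ∈ distinctS S then
      ((2 : ℝ) ^ n)⁻¹ * ∑ y, pInc κ S y * (chiR x y * chiR y x') else 0 := by
  simp only [MS, Matrix.of_apply, aux_entry]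
  split_ifs with h
  · have : ∀ y : BV n, pInc κ S y
        = ∑ U : Finset (BV n), wgt κ S U * (if y ∈ U then 1 else 0) := fun y => by
      unfold wgt
      convert (aux_mean (pInc κ S) y).symm
    simp_rw [this, Finset.mul_sum, Finset.sum_mul, Finset.mul_sum]
    rw [Finset.sum_comm]
    refine Finset.sum_congr rfl fun U _ => Finset.sum_congr rfl fun y _ => ?_
    ring
  · simp

lemma aux_dev {n ℓ : ℕ} (κ : ℝ) (S : Fin ℓ → BV n) (U : Finset (BV n)) (x x' : BV n)
    (hx : x ∈ distinctS S) (hx' : x' ∈ distinctS S) :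
    MSU S U x x' - MS κ S x x' = ((2 : ℝ) ^ n)⁻¹ *
      ∑ y, ((if y ∈ U then 1 else 0) - pInc κ S y) * (chiR x y * chiR y x') := by
  rw [aux_entry, aux_MS, if_pos ⟨hx, hx'⟩, if_pos ⟨hx, hx'⟩, ← mul_sub, ← Finset.sum_sub_distrib]
  simp only [sub_mul]

lemma aux_good {n ℓ : ℕ} (κ ρ : ℝ) (hρ : 0 < ρ) (S : Fin ℓ → BV n) (U : Finset (BV n))
    (h : ∀ i j, |MSU S U (S i) (S j) - MS κ S (S i) (S j)| ≤ ρ / ℓ) :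
    opN (MS κ S) - ρ ≤ opN (MSU S U) ∧
              ∀ Δ : Finset (BV n), ↑Δ ⊆ Set.range S →
                opN (subM (MSU S U) Δ) ≤ opN (subM (MS κ S) Δ) + ρ := by
  have hcard : (distinctS S).card ≤ ℓ := by
    unfold distinctS
    exact Finset.card_image_le.trans (by simp)
  have hd : ∀ x ∈ distinctS S, ∀ y ∈ distinctS S, |MSU S U x y - MS κ S x y| ≤ ρ / ℓ := by
    intro x hx y hy
    obtain ⟨i, -, rfl⟩ := Finset.mem_image.1 hx
    obtain ⟨j, -, rfl⟩ := Finset.mem_image.1 hy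
    exact h i j
  constructor
  · have h1 := aux_sub (MS κ S) (MSU S U)
    have h2 : opN (MS κ S - MSU S U) ≤ ρ := by
      refine aux_opN _ (distinctS S) ℓ ρ hρ hcard ?_ ?_
      · intro x y hxy
        rw [Matrix.sub_apply, aux_entry, aux_MS, if_neg hxy, if_neg hxy, sub_zero]
      · intro x hx y hy
        rw [Matrix.sub_apply, abs_sub_comm]
        exact hd x hx y hy
    linarith
  · intro Δ hΔ
    have hsub : ∀ x ∈ Δ, x ∈ distinctS S := fun x hx => by
      obtain ⟨i, rfl⟩ := hΔ hx
      exact Finset.mem_image_of_mem _ (Finset.mem_univ i)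
    refine (aux_sub (subM (MSU S U) Δ) (subM (MS κ S) Δ)).trans ?_
    gcongr
    refine aux_opN _ Finset.univ ℓ ρ hρ ?_ ?_ ?_
    · rw [Finset.card_univ, Fintype.card_coe]
      exact (Finset.card_le_card hsub).trans hcard
    · intro x y hxy; simp at hxy
    · intro x _ y _
      exact hd _ (hsub _ x.2) _ (hsub _ y.2)

lemma aux_pair {n ℓ : ℕ} (κ ρ : ℝ) (hκ0 : 0 ≤ κ) (hρ : 0 < ρ) (S : Fin ℓ → BV n) (i j : Fin ℓ) :
    (∑ U : Finset (BV n), if ρ / ℓ < |MSU S U (S i) (S j) - MS κ S (S i) (S j)|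
      then wgt κ S U else 0)
      ≤ 2 * Real.exp (-(ρ ^ 2 * 2 ^ n / (2 * (ℓ : ℝ) ^ 2))) := by
  have hc : (Fintype.card (BV n) : ℝ) = 2 ^ n := by simp [BV]
  have := aux_tail (pInc κ S) (fun y => chiR (S i) y * chiR y (S j)) (ρ / ℓ) (by positivity)
    (fun y => (aux_p κ hκ0 S y).1) (fun y => (aux_p κ hκ0 S y).2)
    (fun y => by rw [abs_mul, aux_chi, aux_chi, one_mul])
  rw [hc] at this
  have e : (2:ℝ) ^ n * ((ρ / ℓ) ^ 2 / 2) = ρ ^ 2 * 2 ^ n / (2 * (ℓ : ℝ) ^ 2) := by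
    rw [div_pow, div_div, mul_div_assoc', mul_comm (2 ^ n) (ρ ^ 2), mul_comm ((ℓ : ℝ) ^ 2)]
  rw [e] at this
  refine le_trans (le_of_eq ?_) this
  refine Finset.sum_congr rfl fun U _ => ?_
  have hm : ∀ i, S i ∈ distinctS S := fun i => Finset.mem_image_of_mem _ (Finset.mem_univ i)
  rw [aux_dev κ S U _ _ (hm i) (hm j), abs_mul, abs_of_pos (by positivity : 0 < ((2:ℝ) ^ n)⁻¹)]
  have : ∀ g : ℝ, (ρ / ℓ < ((2:ℝ) ^ n)⁻¹ * g) ↔ 2 ^ n * (ρ / ℓ) < g := fun g => by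
    rw [lt_inv_mul_iff₀ (by positivity)]
  unfold wgt
  simp only [this]

/-- operator-norm concentration of `M^{S,U}` and its principal submatrices.
Except with probability at most `2ℓ² e^{−ρ²2^n/(2ℓ²)}` over the random set `U`, both
`‖M^{S,U}‖ ≥ ‖M^S‖ − ρ` and, for every subset `Δ` of the distinct elements of `S`,
`‖M^{S,U}_{[Δ]}‖ ≤ ‖M^S_{[Δ]}‖ + ρ`. -/
theorem opnorm_concentration (n ℓ : ℕ) (κ ρ : ℝ) (hκ0 : 0 ≤ κ) (hκ1 : κ ≤ 1)
    (hρ : 0 < ρ) (S : Fin ℓ → BV n) :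
    (∑ U : Finset (BV n),
        if ¬ (opN (MS κ S) - ρ ≤ opN (MSU S U) ∧
              ∀ Δ : Finset (BV n), ↑Δ ⊆ Set.range S →
                opN (subM (MSU S U) Δ) ≤ opN (subM (MS κ S) Δ) + ρ)
        then wgt κ S U else 0)
      ≤ 2 * (ℓ : ℝ) ^ 2 * Real.exp (-(ρ ^ 2 * 2 ^ n / (2 * (ℓ : ℝ) ^ 2))) := by
  have hw : ∀ U : Finset (BV n), 0 ≤ wgt κ S U := fun U =>
    Finset.prod_nonneg fun y _ => by
      have := aux_p κ hκ0 S y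
      split_ifs <;> linarith
  calc _ ≤ ∑ U : Finset (BV n), ∑ i, ∑ j,
        if ρ / ℓ < |MSU S U (S i) (S j) - MS κ S (S i) (S j)| then wgt κ S U else 0 := by
        refine Finset.sum_le_sum fun U _ => ?_
        have hnn : ∀ i j, 0 ≤ if ρ / ℓ < |MSU S U (S i) (S j) - MS κ S (S i) (S j)|
            then wgt κ S U else 0 := fun i j => by
          have := hw U
          split_ifs <;> linarith
        split_ifs with hbad
        · exact Finset.sum_nonneg fun i _ => Finset.sum_nonneg fun j _ => hnn i j
        · have hex : ∃ i j, ρ / ℓ < |MSU S U (S i) (S j) - MS κ S (S i) (S j)| := by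
            by_contra hcon
            push Not at hcon
            exact hbad (aux_good κ ρ hρ S U hcon)
          obtain ⟨i, j, hij⟩ := hex
          calc wgt κ S U = if ρ / ℓ < |MSU S U (S i) (S j) - MS κ S (S i) (S j)|
                then wgt κ S U else 0 := by rw [if_pos hij]
            _ ≤ ∑ j, if ρ / ℓ < |MSU S U (S i) (S j) - MS κ S (S i) (S j)|
                then wgt κ S U else 0 :=
                Finset.single_le_sum (f := fun j =>
                  if ρ / ℓ < |MSU S U (S i) (S j) - MS κ S (S i) (S j)| then wgt κ S U else 0)
                  (fun j _ => hnn i j) (Finset.mem_univ j)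
            _ ≤ _ := Finset.single_le_sum (f := fun i => ∑ j,
                  if ρ / ℓ < |MSU S U (S i) (S j) - MS κ S (S i) (S j)| then wgt κ S U else 0)
                  (fun i _ => Finset.sum_nonneg fun j _ => hnn i j) (Finset.mem_univ i)
    _ = ∑ i, ∑ j, ∑ U : Finset (BV n),
        if ρ / ℓ < |MSU S U (S i) (S j) - MS κ S (S i) (S j)| then wgt κ S U else 0 := by
        rw [Finset.sum_comm]
        exact Finset.sum_congr rfl fun i _ => Finset.sum_comm
    _ ≤ ∑ i : Fin ℓ, ∑ j : Fin ℓ, 2 * Real.exp (-(ρ ^ 2 * 2 ^ n / (2 * (ℓ : ℝ) ^ 2))) :=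
        Finset.sum_le_sum fun i _ => Finset.sum_le_sum fun j _ => aux_pair κ ρ hκ0 hρ S i j
    _ = _ := by
        simp only [Finset.sum_const, Finset.card_univ, Fintype.card_fin, nsmul_eq_mul]
        ring
end

section
/- Let κ ∈ [0,1], let S be a good multiset of size ℓ ≥ 1 over {0,1}^n, and let Δ be a nonempty subset of S. Then the principal submatrix of B^S on Δ equals B^S_{[Δ]} = ((1+κ)/2 − κ/ℓ)·id_Δ + (κ|Δ|/ℓ)·|Δ⟩⟨Δ|, where |Δ⟩ = |Δ|^{−1/2} ∑_{x ∈ Δ} |x⟩. Consequently ‖B^S_{[Δ]}‖_op = (1+κ)/2 + (|Δ|−1)κ/ℓ ≤ (1+κ)/2 + |Δ|κ/ℓ. -/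
open scoped BigOperators

attribute [local instance] Classical.propDecidable

/-- `B^S = H^{⊗n} · Diag[(1/2 + (κ/2)γ_y^{(S)})_y] · H^{⊗n}`. -/
noncomputable def BSmat {n ℓ : ℕ} (κ : ℝ) (S : Fin ℓ → BV n) : Matrix (BV n) (BV n) ℝ :=
  Had n * Matrix.diagonal (fun y => 1 / 2 + κ / 2 * gammaS S y) * Had n

theorem aux_zmod2 (a : ZMod 2) : a = 0 ∨ a = 1 := by
  revert a; decide

theorem aux_chi_comm {n : ℕ} (x y : BV n) : chiR x y = chiR y x := by
  unfold chiR
  simp only [mul_comm]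

theorem aux_chi_add {n : ℕ} (x y z : BV n) : chiR x (y + z) = chiR x y * chiR x z := by
  unfold chiR
  simp only [Pi.add_apply, mul_add, Finset.sum_add_distrib]
  have h11 : (1 : ZMod 2) + 1 = 0 := by decide
  rcases aux_zmod2 (∑ j, x j * y j) with h | h <;>
    rcases aux_zmod2 (∑ j, x j * z j) with h' | h' <;> simp [h, h', h11]

theorem aux_chi_zero {n : ℕ} (x : BV n) : chiR x 0 = 1 := by
  simp [chiR]

theorem aux_chi_sum {n : ℕ} (z : BV n) :
    ∑ y : BV n, chiR y z = if z = 0 then (2 : ℝ) ^ n else 0 := by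
  split_ifs with hz
  · subst hz
    simp [aux_chi_zero, ZMod.card]
  · obtain ⟨j, hj⟩ := Function.ne_iff.mp hz
    have hj1 : z j = 1 := (aux_zmod2 (z j)).resolve_left hj
    have h1 : chiR z (Pi.single j 1) = -1 := by
      simp [chiR, Pi.single_apply, hj1]
    have h := Equiv.sum_comp (Equiv.addRight (Pi.single j (1 : ZMod 2) : BV n))
      (fun y => chiR y z)
    have h2 : ∀ y : BV n, chiR (Equiv.addRight (Pi.single j (1 : ZMod 2) : BV n) y) z
        = - chiR y z := by
      intro y
      rw [Equiv.coe_addRight, aux_chi_comm, aux_chi_add, h1, aux_chi_comm]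
      ring
    simp only [h2, Finset.sum_neg_distrib] at h
    linarith

theorem aux_entry_s5 {n ℓ : ℕ} (κ : ℝ) (S : Fin ℓ → BV n) (x x' : BV n) :
    BSmat κ S x x' = (if x + x' = 0 then 1 / 2 else 0)
      + κ / (2 * ℓ) * ∑ i, ∑ j, (if x + x' + S i + S j = 0 then (1 : ℝ) else 0) := by
  have hN : ((2 : ℝ) ^ n) ≠ 0 := by positivity
  have hg : ∀ y, gammaS S y = (ℓ : ℝ)⁻¹ * ∑ i, ∑ j, chiR y (S i + S j) := by
    intro y
    unfold gammaS
    rw [mul_pow, inv_pow, Real.sq_sqrt (Nat.cast_nonneg _), sq, Finset.sum_mul_sum]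
    simp only [aux_chi_add]
  have hs : (Real.sqrt ((2 : ℝ) ^ n))⁻¹ * (Real.sqrt ((2 : ℝ) ^ n))⁻¹ = ((2 : ℝ) ^ n)⁻¹ := by
    rw [← mul_inv, Real.mul_self_sqrt (by positivity)]
  have hterm : ∀ y, Had n x y * (1 / 2 + κ / 2 * gammaS S y) * Had n y x'
      = ((2 : ℝ) ^ n)⁻¹ * (1 / 2 * chiR y (x + x')
        + κ / (2 * ℓ) * ∑ i, ∑ j, chiR y (x + x' + S i + S j)) := by
    intro y
    have e : ∑ i, ∑ j, chiR y (x + x' + S i + S j)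
        = chiR y x * chiR y x' * ∑ i, ∑ j, chiR y (S i + S j) := by
      simp only [aux_chi_add, Finset.mul_sum]
      refine Finset.sum_congr rfl fun i _ => Finset.sum_congr rfl fun j _ => by ring
    rw [hg, e, aux_chi_add, ← hs]
    simp only [Had, Matrix.of_apply]
    rw [aux_chi_comm x y]
    field_simp
  unfold BSmat
  rw [Matrix.mul_apply]
  simp only [Matrix.mul_diagonal]
  simp only [hterm]
  rw [← Finset.mul_sum, Finset.sum_add_distrib, ← Finset.mul_sum, ← Finset.mul_sum,
    aux_chi_sum, Finset.sum_comm]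
  have : ∀ i, ∑ y : BV n, ∑ j, chiR y (x + x' + S i + S j)
      = (2 : ℝ) ^ n * ∑ j, (if x + x' + S i + S j = 0 then (1 : ℝ) else 0) := by
    intro i
    rw [Finset.sum_comm]
    simp only [aux_chi_sum, Finset.mul_sum, mul_ite, mul_one, mul_zero]
  simp only [this, ← Finset.mul_sum]
  split_ifs <;> field_simp <;> ring

theorem aux_self {n : ℕ} (x : BV n) : x + x = 0 := by
  funext j
  exact CharTwo.add_self_eq_zero _

theorem aux_eq {n : ℕ} (x y : BV n) : x + y = 0 ↔ x = y := by
  constructor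
  · intro h
    have := congrArg (· + y) h
    simpa [add_assoc, aux_self] using this
  · rintro rfl
    exact aux_self _

theorem aux_inj {n ℓ : ℕ} (S : Fin ℓ → BV n) (hS : IsGood S) (i j : Fin ℓ)
    (h : S i + S j = 0) : i = j := by
  have := hS 1 (by simp) (![i, j] : Fin 2 → Fin ℓ) (by
    show ∑ k : Fin 2, _ = _
    simpa [Fin.sum_univ_two] using h) i
  by_contra hne
  revert this
  show ¬ Even ((Finset.univ.filter fun k : Fin 2 => (![i, j] : Fin 2 → Fin ℓ) k = i).card)
  rw [Finset.card_filter, Fin.sum_univ_two]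
  simp [Ne.symm hne]

theorem aux_four {n ℓ : ℕ} (S : Fin ℓ → BV n) (hS : IsGood S) (a b i j : Fin ℓ) (hab : a ≠ b) :
    S a + S b + S i + S j = 0 ↔ (i = a ∧ j = b) ∨ (i = b ∧ j = a) := by
  constructor
  · intro h
    have key : ∀ c, Even ((if a = c then 1 else 0) + (if b = c then 1 else 0)
        + (if i = c then 1 else 0) + (if j = c then 1 else 0)) := by
      intro c
      have := hS 2 (by simp) (![a, b, i, j] : Fin 4 → Fin ℓ) (by
        show ∑ k : Fin 4, _ = _
        simpa [Fin.sum_univ_four] using h) c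
      change Even ((Finset.univ.filter
        fun k : Fin 4 => (![a, b, i, j] : Fin 4 → Fin ℓ) k = c).card) at this
      rw [Finset.card_filter, Fin.sum_univ_four] at this
      convert this using 1
      congr 1
    have ka := key a
    have kb := key b
    simp only [hab, Ne.symm hab, if_true, if_false] at ka kb
    by_cases h1 : i = a <;> by_cases h2 : j = a <;> by_cases h3 : i = b <;>
      by_cases h4 : j = b <;> simp_all (decide := true)
  · rintro (⟨rfl, rfl⟩ | ⟨rfl, rfl⟩)
    · rw [add_assoc, aux_self]
    · rw [add_assoc, add_comm (S i) (S j), aux_self]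

theorem aux_entry_good {n ℓ : ℕ} (κ : ℝ) (hℓ : 1 ≤ ℓ) (S : Fin ℓ → BV n) (hS : IsGood S)
    (a b : Fin ℓ) :
    BSmat κ S (S a) (S b) = if S a = S b then (1 + κ) / 2 else κ / ℓ := by
  have hl : (ℓ : ℝ) ≠ 0 := by positivity
  rw [aux_entry_s5]
  simp only [aux_eq (S a) (S b)]
  by_cases hab : a = b
  · subst hab
    have : ∀ i j, (S a + S a + S i + S j = 0) ↔ i = j := by
      intro i j
      rw [aux_self, zero_add]
      exact ⟨aux_inj S hS i j, fun h => h ▸ aux_self _⟩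
    simp only [this]
    simp
    field_simp
  · have hne : S a ≠ S b := fun h => hab (aux_inj S hS a b ((aux_eq _ _).2 h))
    simp only [aux_four S hS a b _ _ hab, hne, if_false]
    have : ∀ i j : Fin ℓ, (if (i = a ∧ j = b) ∨ (i = b ∧ j = a) then (1 : ℝ) else 0)
        = (if i = a then (if j = b then 1 else 0) else 0)
          + (if i = b then (if j = a then 1 else 0) else 0) := by
      intro i j
      by_cases h1 : i = a <;> by_cases h2 : j = a <;> by_cases h3 : i = b <;>
        by_cases h4 : j = b <;> simp_all
    simp only [this, Finset.sum_add_distrib]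
    have h2 : ∀ c d : Fin ℓ,
        ∑ i : Fin ℓ, ∑ j : Fin ℓ, (if i = c then (if j = d then (1 : ℝ) else 0) else 0) = 1 := by
      intro c d
      rw [Finset.sum_eq_single c]
      · simp
      · intro i _ hi
        simp [hi]
      · simp
    rw [h2, h2]
    field_simp
    norm_num

theorem aux_norm {m : Type*} [Fintype m] [DecidableEq m] (a c : ℝ) (ha : 0 ≤ a) (hc : 0 ≤ c)
    (v : m → ℝ) (hv : ∑ i, v i * v i = 1) :
    opN (a • (1 : Matrix m m ℝ) + c • Matrix.vecMulVec v v) = a + c := by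
  set V : EuclideanSpace ℝ m := WithLp.toLp 2 v with hV
  have hVn : ‖V‖ = 1 := by
    rw [EuclideanSpace.norm_eq]
    simp [hV, sq, hv]
  have hact : ∀ w : EuclideanSpace ℝ m,
      Matrix.toEuclideanLin (a • (1 : Matrix m m ℝ) + c • Matrix.vecMulVec v v) w
        = a • w + (c * inner ℝ V w) • V := by
    intro w
    ext i
    simp [Matrix.toEuclideanLin_apply, Matrix.add_mulVec, Matrix.smul_mulVec,
      Matrix.vecMulVec_mulVec, hV, PiLp.inner_apply, dotProduct, mul_comm, mul_assoc, mul_left_comm]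
  unfold opN
  apply le_antisymm
  · refine ContinuousLinearMap.opNorm_le_bound _ (by positivity) fun w => ?_
    rw [LinearMap.coe_toContinuousLinearMap', hact]
    have h1 : |inner ℝ V w| ≤ ‖w‖ := by
      have := abs_real_inner_le_norm V w
      rwa [hVn, one_mul] at this
    calc ‖a • w + (c * inner ℝ V w) • V‖ ≤ ‖a • w‖ + ‖(c * inner ℝ V w) • V‖ := norm_add_le _ _
      _ = a * ‖w‖ + c * |inner ℝ V w| := by
        rw [norm_smul, norm_smul, hVn, Real.norm_eq_abs, Real.norm_eq_abs, abs_mul,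
          abs_of_nonneg ha, abs_of_nonneg hc, mul_one]
      _ ≤ a * ‖w‖ + c * ‖w‖ := by gcongr
      _ = (a + c) * ‖w‖ := by ring
  · have h := ContinuousLinearMap.le_opNorm (LinearMap.toContinuousLinearMap
      (Matrix.toEuclideanLin (a • (1 : Matrix m m ℝ) + c • Matrix.vecMulVec v v))) V
    rw [LinearMap.coe_toContinuousLinearMap', hact, real_inner_self_eq_norm_sq, hVn,
      ← add_smul, norm_smul, hVn, Real.norm_eq_abs] at h
    have := le_abs_self (a + c * 1 ^ 2)
    linarith

/-- explicit form of `B^S_{[Δ]}`.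
For good `S` of size `ℓ ≥ 1` and a nonempty `Δ ⊆ S`:
`B^S_{[Δ]} = ((1+κ)/2 − κ/ℓ)·id + (κ|Δ|/ℓ)·|Δ⟩⟨Δ|`, hence
`‖B^S_{[Δ]}‖ = (1+κ)/2 + (|Δ|−1)κ/ℓ ≤ (1+κ)/2 + |Δ|κ/ℓ`. -/
theorem BS_submatrix_form (n ℓ : ℕ) (κ : ℝ) (hκ0 : 0 ≤ κ) (hκ1 : κ ≤ 1) (hℓ : 1 ≤ ℓ)
    (S : Fin ℓ → BV n) (hS : IsGood S)
    (Δ : Finset (BV n)) (hΔne : Δ.Nonempty) (hΔ : ↑Δ ⊆ Set.range S) :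
    subM (BSmat κ S) Δ =
        ((1 + κ) / 2 - κ / (ℓ : ℝ)) • (1 : Matrix {x // x ∈ Δ} {x // x ∈ Δ} ℝ)
          + (κ * (Δ.card : ℝ) / (ℓ : ℝ)) •
              Matrix.vecMulVec (fun _ : {x // x ∈ Δ} => (Real.sqrt (Δ.card : ℝ))⁻¹)
                (fun _ : {x // x ∈ Δ} => (Real.sqrt (Δ.card : ℝ))⁻¹) ∧
    opN (subM (BSmat κ S) Δ) = (1 + κ) / 2 + ((Δ.card : ℝ) - 1) * κ / (ℓ : ℝ) ∧
    opN (subM (BSmat κ S) Δ) ≤ (1 + κ) / 2 + (Δ.card : ℝ) * κ / (ℓ : ℝ) := by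
  have hl1 : (1 : ℝ) ≤ ℓ := by exact_mod_cast hℓ
  have hl : (0 : ℝ) < ℓ := by linarith
  have hd : (0 : ℝ) < Δ.card := by exact_mod_cast hΔne.card_pos
  have hsq : (Real.sqrt (Δ.card : ℝ))⁻¹ * (Real.sqrt (Δ.card : ℝ))⁻¹ = (Δ.card : ℝ)⁻¹ := by
    rw [← mul_inv, Real.mul_self_sqrt hd.le]
  have hform : subM (BSmat κ S) Δ =
        ((1 + κ) / 2 - κ / (ℓ : ℝ)) • (1 : Matrix {x // x ∈ Δ} {x // x ∈ Δ} ℝ)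
          + (κ * (Δ.card : ℝ) / (ℓ : ℝ)) •
              Matrix.vecMulVec (fun _ : {x // x ∈ Δ} => (Real.sqrt (Δ.card : ℝ))⁻¹)
                (fun _ : {x // x ∈ Δ} => (Real.sqrt (Δ.card : ℝ))⁻¹) := by
    ext ⟨x, hx⟩ ⟨y, hy⟩
    obtain ⟨a, rfl⟩ := hΔ hx
    obtain ⟨b, rfl⟩ := hΔ hy
    simp only [subM, Matrix.submatrix_apply, Matrix.add_apply, Matrix.smul_apply,
      Matrix.vecMulVec_apply, hsq, smul_eq_mul, aux_entry_good κ hℓ S hS, Matrix.one_apply,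
      Subtype.mk.injEq]
    split_ifs <;> field_simp <;> ring
  have hk : κ / (ℓ : ℝ) ≤ κ := div_le_self hκ0 hl1
  have hnorm : opN (subM (BSmat κ S) Δ)
      = (1 + κ) / 2 + ((Δ.card : ℝ) - 1) * κ / (ℓ : ℝ) := by
    rw [hform, aux_norm _ _ (by linarith) (by positivity)]
    · field_simp
      ring
    · simp [hsq, hd.ne']
  refine ⟨hform, hnorm, ?_⟩
  rw [hnorm]
  gcongr
  linarith
end

section
/- For all integers r, k ≥ 0 and all y_1, …, y_k ∈ {0,1}^n, the following operator identity holds on the ℓ-boson space: (id − Con_{r+2k}) · H̃_{y_k} ⋯ H̃_{y_1} · Con_r = 0. That is, a product of k double-momentum hopping operators maps the span of r-condensate momentum Fock states into the span of (r+2k)-condensate momentum Fock states. -/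
open scoped BigOperators

/-- Occupation tuples: functions assigning a number of bosons to each mode. -/
abbrev OccT (n : ℕ) : Type := BV n → ℕ

/-- The full bosonic Fock space: formal (finitely supported) complex combinations of
position Fock basis states `|u⟩`, one for each occupation tuple `u`. -/
abbrev FockV (n : ℕ) : Type := OccT n →₀ ℂ

/-- Operators on the Fock space. -/
abbrev FockOp (n : ℕ) : Type := Module.End ℂ (FockV n)

/-- The annihilation operator `â_x`: on basis states, `â_x|u⟩ = √(u_x)|u − 1_x⟩`. -/
noncomputable def ann (n : ℕ) (x : BV n) : FockOp n :=
  Finsupp.lift (FockV n) ℂ (OccT n) fun u =>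
    ((Real.sqrt (u x) : ℝ) : ℂ) • Finsupp.single (Function.update u x (u x - 1)) 1

/-- The creation operator `â_x†`: on basis states, `â_x†|u⟩ = √(u_x + 1)|u + 1_x⟩`. -/
noncomputable def cre (n : ℕ) (x : BV n) : FockOp n :=
  Finsupp.lift (FockV n) ℂ (OccT n) fun u =>
    ((Real.sqrt (u x + 1) : ℝ) : ℂ) • Finsupp.single (Function.update u x (u x + 1)) 1

/-- The number operator `n̂_z = â_z† â_z`. -/
noncomputable def numOp (n : ℕ) (z : BV n) : FockOp n := cre n z * ann n z

/-- The momentum annihilation operator `ã_y = 2^{−n/2} ∑_x (−1)^{x·y} â_x`. -/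
noncomputable def mann (n : ℕ) (y : BV n) : FockOp n :=
  (((Real.sqrt ((2 : ℝ) ^ n))⁻¹ : ℝ) : ℂ) • ∑ x : BV n, ((chiR x y : ℝ) : ℂ) • ann n x

/-- The momentum creation operator `ã_y† = 2^{−n/2} ∑_x (−1)^{x·y} â_x†`. -/
noncomputable def mcre (n : ℕ) (y : BV n) : FockOp n :=
  (((Real.sqrt ((2 : ℝ) ^ n))⁻¹ : ℝ) : ℂ) • ∑ x : BV n, ((chiR x y : ℝ) : ℂ) • cre n x

/-- The vacuum state `|vac⟩`. -/
noncomputable def vac (n : ℕ) : FockV n := Finsupp.single 0 1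

/-- The momentum Fock state `|ũ⟩ = (∏_x (ã_x†)^{u_x}/√(u_x!)) |vac⟩`. -/
noncomputable def momFock (n : ℕ) (u : OccT n) : FockV n :=
  (((∏ x : BV n, Real.sqrt ((u x).factorial) : ℝ)⁻¹ : ℝ) : ℂ) •
    ((Finset.univ.toList (α := BV n)).map fun x => (mcre n x) ^ (u x)).prod (vac n)

/-- The number of modes `x ≠ 0` with an odd number of bosons. -/
def oddCount (n : ℕ) (u : OccT n) : ℕ :=
  (Finset.univ.filter fun x : BV n => x ≠ 0 ∧ Odd (u x)).card

/-- The orthogonal projection (in the `ℓ`-boson space) onto the span of the momentum Fock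
states `|ũ⟩` over occupation tuples `u` with `∑_x u_x = ℓ` satisfying `P`.  Since the
momentum Fock states `{|ũ⟩ : ∑ u = ℓ}` form an orthonormal basis of the `ℓ`-boson space,
this projection equals `∑_u |ũ⟩⟨ũ|`, which on a position basis state `|w⟩` gives
`∑_u conj(⟨w|ũ⟩) |ũ⟩`. -/
noncomputable def projOn (n ℓ : ℕ) (P : OccT n → Prop) [DecidablePred P] : FockOp n :=
  Finsupp.lift (FockV n) ℂ (OccT n) fun w =>
    ∑ v : BV n → Fin (ℓ + 1),
      if (∑ x, ((v x : ℕ))) = ℓ ∧ P (fun x => (v x : ℕ))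
      then (starRingEnd ℂ) (momFock n (fun x => (v x : ℕ)) w) • momFock n (fun x => (v x : ℕ))
      else 0

/-- `Con_r` (`conProj`): the projection onto the span of momentum Fock states of `r`-condensate tuples
(`ℓ`-boson tuples with at least `ℓ − r` bosons in the `0`-momentum mode). -/
noncomputable def conProj (n ℓ r : ℕ) : FockOp n :=
  projOn n ℓ fun u => ℓ - r ≤ u 0

/-- `QEC_{(r,o)}`: the projection onto the span of momentum Fock states of
`(r,o)`-quasi-even condensate tuples. -/
noncomputable def QEC (n ℓ r o : ℕ) : FockOp n :=
  projOn n ℓ fun u => ℓ - r ≤ u 0 ∧ oddCount n u ≤ o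

/-- `QE_{=o}`: the projection onto momentum Fock states with exactly `o` odd
nonzero-momentum modes. -/
noncomputable def QEeq (n ℓ o : ℕ) : FockOp n :=
  projOn n ℓ fun u => oddCount n u = o

/-- `QEC_{(R,=o)}`: the projection onto momentum Fock states of `R`-condensate tuples with
exactly `o` odd nonzero-momentum modes. -/
noncomputable def QECeq (n ℓ R o : ℕ) : FockOp n :=
  projOn n ℓ fun u => (ℓ - R ≤ u 0 ∧ oddCount n u = o)

/-- The squared Hilbert norm `‖ψ‖² = ∑_u |ψ_u|²`. -/
noncomputable def nsq (n : ℕ) (ψ : FockV n) : ℝ := ψ.sum fun _ c => Complex.normSq c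

/-- The inner product `⟨φ, ψ⟩ = ∑_u conj(φ_u) ψ_u` (antilinear in the first argument). -/
noncomputable def finner (n : ℕ) (φ ψ : FockV n) : ℂ :=
  φ.sum fun u c => (starRingEnd ℂ) c * ψ u

/-- The single `y`-momentum hopping operator `G̃_y = ℓ^{−1/2} ∑_x ã_{x⊕y}† ã_x`. -/
noncomputable def sHop (n ℓ : ℕ) (y : BV n) : FockOp n :=
  (((Real.sqrt (ℓ : ℝ))⁻¹ : ℝ) : ℂ) • ∑ x : BV n, mcre n (x + y) * mann n x

/-- The double `y`-momentum hopping operator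
`H̃_y = ℓ^{−1} ∑_{x,x'} ã_{x⊕y}† ã_{x'⊕y}† ã_x ã_{x'}`. -/
noncomputable def dHop (n ℓ : ℕ) (y : BV n) : FockOp n :=
  ((ℓ : ℂ))⁻¹ • ∑ x : BV n, ∑ x' : BV n,
    mcre n (x + y) * mcre n (x' + y) * mann n x * mann n x'

theorem sgn_add (a b : ZMod 2) :
    (if a + b = 0 then (1:ℝ) else -1) = (if a = 0 then 1 else -1) * (if b = 0 then 1 else -1) := by
  have h : ∀ a b : ZMod 2, (a + b = 0 ↔ (a = 0 ↔ b = 0)) := by decide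
  have := h a b
  by_cases ha : a = 0 <;> by_cases hb : b = 0 <;> simp_all

theorem chiR_add_right {n : ℕ} (z x y : BV n) : chiR z (x + y) = chiR z x * chiR z y := by
  unfold chiR
  rw [← sgn_add]
  simp [mul_add, Finset.sum_add_distrib]

theorem chiR_add_left {n : ℕ} (z x y : BV n) : chiR (x + y) z = chiR x z * chiR y z := by
  unfold chiR
  rw [← sgn_add]
  simp [add_mul, Finset.sum_add_distrib]

theorem chiR_sum {n : ℕ} (y : BV n) (hy : y ≠ 0) : ∑ z : BV n, chiR z y = 0 := by
  obtain ⟨j, hj⟩ := Function.ne_iff.mp hy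
  have h1 : chiR (Pi.single j 1 : BV n) y = -1 := by
    unfold chiR
    have : ∑ i, (Pi.single j 1 : BV n) i * y i = y j := by
      simp [Pi.single_apply]
    rw [this]
    exact if_neg hj
  have h2 : ∑ z : BV n, chiR z y = ∑ z : BV n, chiR (z + Pi.single j 1) y :=
    (Equiv.sum_comp (Equiv.addRight (Pi.single j 1 : BV n)) (fun z => chiR z y)).symm
  simp only [chiR_add_left, h1] at h2
  rw [← Finset.sum_mul] at h2
  linarith

theorem chiR_orth {n : ℕ} (x y : BV n) :
    ∑ z : BV n, chiR z x * chiR z y = if x = y then (2:ℝ)^n else 0 := by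
  simp only [← chiR_add_right]
  split_ifs with h
  · subst h
    have : x + x = 0 := by
      funext i
      have : ∀ a : ZMod 2, a + a = 0 := by decide
      exact this _
    rw [this]
    simp [chiR]
  · apply chiR_sum
    intro h0
    apply h
    funext i
    have : ∀ a b : ZMod 2, a + b = 0 → a = b := by decide
    exact this _ _ (congrFun h0 i)

theorem ann_single (n : ℕ) (x : BV n) (u : OccT n) (c : ℂ) :
    ann n x (Finsupp.single u c) =
      Finsupp.single (Function.update u x (u x - 1)) (c * ((Real.sqrt (u x) : ℝ) : ℂ)) := by
  simp [ann]

theorem cre_single (n : ℕ) (x : BV n) (u : OccT n) (c : ℂ) :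
    cre n x (Finsupp.single u c) =
      Finsupp.single (Function.update u x (u x + 1)) (c * ((Real.sqrt (u x + 1) : ℝ) : ℂ)) := by
  simp [cre]

theorem cre_comm (n : ℕ) (x y : BV n) : cre n x * cre n y = cre n y * cre n x := by
  rcases eq_or_ne x y with rfl | h
  · rfl
  apply Finsupp.lhom_ext
  intro u c
  simp only [Module.End.mul_apply, cre_single]
  rw [Function.update_of_ne h, Function.update_of_ne h.symm, Function.update_comm h]
  congr 1
  ring

theorem ann_cre (n : ℕ) (x y : BV n) :
    ann n x * cre n y = cre n y * ann n x + (if x = y then 1 else 0 : ℂ) • (1 : FockOp n) := by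
  apply Finsupp.lhom_ext
  intro u c
  simp only [Module.End.mul_apply, LinearMap.add_apply, LinearMap.smul_apply, Module.End.one_apply,
    cre_single, ann_single]
  rcases eq_or_ne x y with rfl | h
  · simp only [Function.update_self, Function.update_idem, if_true, one_smul]
    rcases Nat.eq_zero_or_pos (u x) with h0 | h0
    · simp [h0]
      rw [← h0, Function.update_eq_self]
    · rw [Nat.sub_add_cancel h0]
      simp only [Nat.add_sub_cancel, Function.update_eq_self]
      rw [← Finsupp.single_add]
      congr 1
      have e1 : ((Real.sqrt ((u x : ℝ) + 1) : ℝ) : ℂ) * ((Real.sqrt ((u x : ℝ) + 1) : ℝ) : ℂ)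
          = u x + 1 := by
        rw [← Complex.ofReal_mul, Real.mul_self_sqrt (by positivity)]; simp
      have e2 : ((Real.sqrt (u x : ℝ) : ℝ) : ℂ) * ((Real.sqrt (u x : ℝ) : ℝ) : ℂ)
          = u x := by
        rw [← Complex.ofReal_mul, Real.mul_self_sqrt (by positivity)]; simp
      have e3 : (((u x - 1 : ℕ) : ℝ) + 1) = u x := by
        rw [Nat.cast_sub h0]; simp
      rw [e3]
      push_cast
      rw [mul_assoc, mul_assoc, e1, e2]
      ring
  · simp only [h, if_false, zero_smul, add_zero]
    rw [Function.update_of_ne h, Function.update_of_ne h.symm, Function.update_comm h]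
    congr 1
    ring

theorem mcre_comm (n : ℕ) (x y : BV n) : Commute (mcre n x) (mcre n y) := by
  unfold mcre
  apply Commute.smul_left
  apply Commute.smul_right
  apply Commute.sum_left
  intro i _
  apply Commute.sum_right
  intro j _
  apply Commute.smul_left
  apply Commute.smul_right
  exact cre_comm n i j

theorem mann_mcre (n : ℕ) (x y : BV n) :
    mann n x * mcre n y = mcre n y * mann n x + (if x = y then 1 else 0 : ℂ) • (1 : FockOp n) := by
  have key : ∀ s : ℂ, (∑ a : BV n, ((chiR a x : ℝ) : ℂ) • ann n a) *
      (∑ b : BV n, ((chiR b y : ℝ) : ℂ) • cre n b) =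
      (∑ b : BV n, ((chiR b y : ℝ) : ℂ) • cre n b) * (∑ a : BV n, ((chiR a x : ℝ) : ℂ) • ann n a)
      + ((∑ z : BV n, chiR z x * chiR z y : ℝ) : ℂ) • (1 : FockOp n) := by
    intro s
    rw [Finset.sum_mul_sum, Finset.sum_mul_sum, Finset.sum_comm (s := Finset.univ) (t := Finset.univ)]
    rw [Complex.ofReal_sum, Finset.sum_smul, ← Finset.sum_add_distrib]
    refine Finset.sum_congr rfl fun b _ => ?_
    simp only [smul_mul_smul_comm, ann_cre, smul_add, Finset.sum_add_distrib, smul_smul]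
    congr 1
    · refine Finset.sum_congr rfl fun a _ => ?_
      rw [mul_comm]
    · simp [← Finset.sum_smul]
  unfold mann mcre
  rw [smul_mul_smul_comm, smul_mul_smul_comm, key 0, smul_add, smul_smul, chiR_orth]
  congr 2
  split_ifs
  · rw [← Complex.ofReal_mul, ← Complex.ofReal_mul, ← mul_inv,
      Real.mul_self_sqrt (by positivity), inv_mul_cancel₀ (by positivity)]
    simp
  · simp

theorem mann_vac (n : ℕ) (x : BV n) : mann n x (vac n) = 0 := by
  simp [mann, vac, ann_single, LinearMap.sum_apply]

/-- Unnormalized momentum state. -/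
noncomputable def MM (n : ℕ) (u : OccT n) : FockV n :=
  ((Finset.univ.toList (α := BV n)).map fun x => (mcre n x) ^ (u x)).prod (vac n)

theorem list_mcre_not_mem (n : ℕ) (x : BV n) (u : OccT n) (l : List (BV n)) (hx : x ∉ l) :
    (l.map fun z => (mcre n z) ^ ((u + Pi.single x 1 : OccT n) z)).prod
      = (l.map fun z => (mcre n z) ^ (u z)).prod := by
  congr 1
  apply List.map_congr_left
  intro z hz
  have : z ≠ x := fun h => hx (h ▸ hz)
  simp [this]

theorem list_mcre (n : ℕ) (x : BV n) (u : OccT n) (l : List (BV n)) (hl : l.Nodup) (hx : x ∈ l) :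
    (l.map fun z => (mcre n z) ^ ((u + Pi.single x 1 : OccT n) z)).prod
      = mcre n x * (l.map fun z => (mcre n z) ^ (u z)).prod := by
  induction l with
  | nil => simp at hx
  | cons a l ih =>
    rw [List.nodup_cons] at hl
    simp only [List.map_cons, List.prod_cons]
    by_cases h : x = a
    · subst h
      rw [list_mcre_not_mem n x u l hl.1]
      simp [pow_succ', mul_assoc]
    · have hx' : x ∈ l := by simpa [h] using hx
      rw [ih hl.2 hx', ← mul_assoc, ← mul_assoc]
      have : (u + Pi.single x 1 : OccT n) a = u a := by simp [Ne.symm h]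
      rw [this, ((mcre_comm n x a).pow_right (u a)).eq]

theorem mcre_MM (n : ℕ) (x : BV n) (u : OccT n) : mcre n x (MM n u) = MM n (u + Pi.single x 1) := by
  unfold MM
  rw [list_mcre n x u _ (Finset.nodup_toList _) (by simp)]
  rfl

theorem MM_zero (n : ℕ) : MM n 0 = vac n := by
  simp [MM]

theorem occ_induction {n : ℕ} (p : OccT n → Prop) (h0 : p 0)
    (h1 : ∀ u x, p u → p (u + Pi.single x 1)) (u : OccT n) : p u := by
  induction hs : ∑ x, u x generalizing u with
  | zero =>
    have : u = 0 := by
      funext x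
      simp only [Finset.sum_eq_zero_iff, Finset.mem_univ, true_implies] at hs
      exact hs x
    rwa [this]
  | succ m ih =>
    obtain ⟨x, hx⟩ : ∃ x, u x ≠ 0 := by
      by_contra! hc
      simp [hc] at hs
    have hle : (Pi.single x 1 : OccT n) ≤ u := by
      intro z
      by_cases h : z = x
      · subst h; simp; omega
      · simp [h]
    have e : u - Pi.single x 1 + Pi.single x 1 = u := tsub_add_cancel_of_le hle
    rw [← e]
    apply h1
    apply ih
    rw [← e] at hs
    simp only [Pi.add_apply, Finset.sum_add_distrib] at hs
    simpa using hs

theorem mann_MM (n : ℕ) (x : BV n) (u : OccT n) :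
    mann n x (MM n u) = (u x : ℂ) • MM n (u - Pi.single x 1) := by
  induction u using occ_induction with
  | h0 => simp [MM_zero, mann_vac]
  | h1 u y ih =>
    rw [← mcre_MM, ← Module.End.mul_apply, mann_mcre]
    simp only [LinearMap.add_apply, Module.End.mul_apply, ih, map_smul, mcre_MM,
      LinearMap.smul_apply, Module.End.one_apply]
    have hA : (u x : ℂ) • MM n (u - Pi.single x 1 + Pi.single y 1)
        = (u x : ℂ) • MM n (u + Pi.single y 1 - Pi.single x 1) := by
      rcases Nat.eq_zero_or_pos (u x) with h | h
      · simp [h]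
      · congr 2
        funext z
        by_cases hz : z = x
        · subst hz; simp; omega
        · simp [hz]
    rw [hA]
    rcases eq_or_ne x y with rfl | h
    · simp [add_smul]
    · simp [h]

/-- Inner product against `φ`, linear in the second argument. -/
noncomputable def ip (n : ℕ) (φ : FockV n) : FockV n →ₗ[ℂ] ℂ :=
  Finsupp.lift ℂ ℂ (OccT n) fun w => (starRingEnd ℂ) (φ w)

theorem ip_single (n : ℕ) (φ : FockV n) (w : OccT n) (c : ℂ) :
    ip n φ (Finsupp.single w c) = c * (starRingEnd ℂ) (φ w) := by
  simp [ip]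

theorem ip_add (n : ℕ) (φ φ' : FockV n) : ip n (φ + φ') = ip n φ + ip n φ' := by
  apply Finsupp.lhom_ext
  intro u c
  simp [ip_single, mul_add]

theorem ip_smul (n : ℕ) (a : ℂ) (φ : FockV n) : ip n (a • φ) = (starRingEnd ℂ a) • ip n φ := by
  apply Finsupp.lhom_ext
  intro u c
  simp [ip_single]
  ring

theorem ip_zero (n : ℕ) : ip n 0 = 0 := by
  simpa using ip_smul n 0 0

theorem ip_sum {ι : Type*} (n : ℕ) (s : Finset ι) (f : ι → FockV n) :
    ip n (∑ i ∈ s, f i) = ∑ i ∈ s, ip n (f i) := by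
  classical
  induction s using Finset.induction_on with
  | empty => simp [ip_zero]
  | insert a s ha ih => simp [Finset.sum_insert ha, ip_add, ih]

theorem ip_cre (n : ℕ) (x : BV n) (φ ψ : FockV n) :
    ip n (cre n x φ) ψ = ip n φ (ann n x ψ) := by
  induction φ using Finsupp.induction_linear with
  | zero => simp [ip_zero]
  | add f g hf hg => simp [ip_add, hf, hg]
  | single u c =>
    induction ψ using Finsupp.induction_linear with
    | zero => simp
    | add f g hf hg => simp [hf, hg]
    | single v d =>
      rw [cre_single, ann_single, ip_single, ip_single]
      by_cases hv : v x = 0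
      · have : Function.update u x (u x + 1) ≠ v := by
          intro h
          rw [← h] at hv
          simp at hv
        simp [hv, this]
      · by_cases h : Function.update u x (u x + 1) = v
        · have h' : u = Function.update v x (v x - 1) := by
            rw [← h]; simp
          rw [← h', h]
          have : ((u x : ℝ) + 1) = v x := by rw [← h]; simp
          rw [this]
          simp
          ring
        · have h' : u ≠ Function.update v x (v x - 1) := by
            intro h'
            apply h
            rw [h']
            simp
            omega
          simp [h, h']

theorem ip_mcre (n : ℕ) (x : BV n) (φ ψ : FockV n) :
    ip n (mcre n x φ) ψ = ip n φ (mann n x ψ) := by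
  simp only [mcre, mann, LinearMap.smul_apply, LinearMap.sum_apply, ip_smul, ip_sum, map_smul,
    map_sum, ip_cre, Complex.conj_ofReal]

theorem ip_vac_mcre (n : ℕ) (x : BV n) (φ : FockV n) : ip n (vac n) (mcre n x φ) = 0 := by
  have h : ∀ z, ip n (vac n) (cre n z φ) = 0 := by
    intro z
    induction φ using Finsupp.induction_linear with
    | zero => simp
    | add f g hf hg => simp [hf, hg]
    | single u c =>
      rw [cre_single, ip_single, vac]
      have : (0 : OccT n) ≠ Function.update u z (u z + 1) := by
        intro h
        have := congrFun h z
        simp at this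
      simp [this]
  simp [mcre, LinearMap.sum_apply, h]

theorem ip_MM (n : ℕ) (u v : OccT n) :
    ip n (MM n u) (MM n v) = if u = v then ((∏ x, (u x).factorial : ℕ) : ℂ) else 0 := by
  induction u using occ_induction generalizing v with
  | h0 =>
    rw [MM_zero]
    induction v using occ_induction with
    | h0 => simp [MM_zero, vac, ip_single]
    | h1 v y _ =>
      rw [← mcre_MM, ip_vac_mcre, if_neg]
      intro h
      have := congrFun h y
      simp at this
  | h1 u x ih =>
    rw [← mcre_MM, ip_mcre, mann_MM, map_smul, ih]
    by_cases h : u + Pi.single x 1 = v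
    · subst h
      have hp : ∏ z, ((u + Pi.single x 1 : OccT n) z).factorial
          = (u x + 1) * ∏ z, (u z).factorial := by
        rw [Finset.prod_eq_mul_prod_sdiff_singleton_of_mem (Finset.mem_univ x),
          Finset.prod_eq_mul_prod_sdiff_singleton_of_mem (Finset.mem_univ x)
            (fun z => (u z).factorial), ← mul_assoc]
        congr 1
        · simp [Nat.factorial_succ]
        · refine Finset.prod_congr rfl fun z hz => ?_
          have : z ≠ x := by simpa using hz
          simp [this]
      rw [hp]
      simp
    · rw [if_neg h]
      by_cases hv : v x = 0
      · simp [hv]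
      · rw [if_neg, smul_zero]
        intro h'
        apply h
        rw [h']
        funext z
        by_cases hz : z = x
        · subst hz; simp; omega
        · simp [hz]

theorem momFock_eq (n : ℕ) (u : OccT n) : momFock n u =
    (((∏ x : BV n, Real.sqrt ((u x).factorial) : ℝ)⁻¹ : ℝ) : ℂ) • MM n u := rfl

theorem nrm_ne (n : ℕ) (u : OccT n) : (∏ x : BV n, Real.sqrt ((u x).factorial) : ℝ) ≠ 0 := by
  apply Finset.prod_ne_zero_iff.mpr
  intro x _
  have := Nat.factorial_pos (u x)
  positivity

theorem ip_momFock (n : ℕ) (u v : OccT n) :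
    ip n (momFock n u) (momFock n v) = if u = v then 1 else 0 := by
  rw [momFock_eq, momFock_eq, ip_smul, LinearMap.smul_apply, map_smul, ip_MM]
  split_ifs with h
  · subst h
    rw [Complex.conj_ofReal]
    have h1 : ((∏ x, (u x).factorial : ℕ) : ℝ) =
      (∏ x : BV n, Real.sqrt ((u x).factorial) : ℝ) * (∏ x : BV n, Real.sqrt ((u x).factorial) : ℝ) := by
      rw [← Finset.prod_mul_distrib]
      push_cast
      refine Finset.prod_congr rfl fun x _ => ?_
      rw [Real.mul_self_sqrt (by positivity)]
    have h2 : ((∏ x, (u x).factorial : ℕ) : ℂ) = (((∏ x, (u x).factorial : ℕ) : ℝ) : ℂ) := by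
      push_cast; rfl
    rw [h2, h1, smul_eq_mul, smul_eq_mul, ← Complex.ofReal_mul, ← Complex.ofReal_mul]
    have := nrm_ne n u
    rw [← Complex.ofReal_one]
    congr 1
    field_simp
  · simp

theorem projOn_apply (n ℓ : ℕ) (P : OccT n → Prop) [DecidablePred P] (ψ : FockV n) :
    projOn n ℓ P ψ = ∑ v : BV n → Fin (ℓ + 1),
      if (∑ x, ((v x : ℕ))) = ℓ ∧ P (fun x => (v x : ℕ))
      then ip n (momFock n (fun x => (v x : ℕ))) ψ • momFock n (fun x => (v x : ℕ))
      else 0 := by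
  induction ψ using Finsupp.induction_linear with
  | zero => simp
  | add f g hf hg =>
    rw [map_add, hf, hg, ← Finset.sum_add_distrib]
    refine Finset.sum_congr rfl fun v _ => ?_
    split_ifs <;> simp [add_smul]
  | single w c =>
    simp only [projOn, Finsupp.lift_apply, ip_single]
    rw [Finsupp.sum_single_index (by rw [zero_smul]), Finset.smul_sum]
    refine Finset.sum_congr rfl fun v _ => ?_
    split_ifs <;> simp [smul_smul]

theorem projOn_momFock (n ℓ : ℕ) (P : OccT n → Prop) [DecidablePred P] (u : OccT n)
    (hu : ∑ x, u x = ℓ) (hP : P u) : projOn n ℓ P (momFock n u) = momFock n u := by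
  have hlt : ∀ x, u x < ℓ + 1 := by
    intro x
    have : u x ≤ ∑ z, u z := Finset.single_le_sum (fun _ _ => Nat.zero_le _) (Finset.mem_univ x)
    omega
  rw [projOn_apply, Finset.sum_eq_single (fun x => (⟨u x, hlt x⟩ : Fin (ℓ + 1)))]
  · simp only []
    rw [if_pos ⟨hu, hP⟩, ip_momFock]
    simp
  · intro v _ hv
    suffices h0 : ¬ ((fun x => (v x : ℕ)) = u) by
      rw [ip_momFock, if_neg h0, zero_smul, ite_self]
    intro h
    apply hv
    funext x
    apply Fin.ext
    exact congrFun h x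
  · simp

/-- Span of the momentum states with `ℓ - a` bosons, at least `ℓ - t` in the zero mode. -/
noncomputable def WW (n ℓ a t : ℕ) : Submodule ℂ (FockV n) :=
  Submodule.span ℂ {ψ | ∃ u : OccT n, ∑ x, u x + a = ℓ ∧ ℓ ≤ u 0 + t ∧ ψ = MM n u}

theorem mcre_WW (n ℓ a t : ℕ) (x : BV n) (ψ : FockV n) (h : ψ ∈ WW n ℓ (a + 1) t) :
    mcre n x ψ ∈ WW n ℓ a t := by
  refine Submodule.span_induction (p := fun ψ _ => mcre n x ψ ∈ WW n ℓ a t) ?_ ?_ ?_ ?_ h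
  · rintro _ ⟨u, h1, h2, rfl⟩
    rw [mcre_MM]
    refine Submodule.subset_span ⟨_, ?_, ?_, rfl⟩
    · simp [Finset.sum_add_distrib]; omega
    · simp only [Pi.add_apply]; omega
  · simp
  · intro f g _ _ hf hg
    rw [map_add]; exact Submodule.add_mem _ hf hg
  · intro c f _ hf
    rw [map_smul]; exact Submodule.smul_mem _ _ hf

theorem mann_WW (n ℓ a t : ℕ) (x : BV n) (ψ : FockV n) (h : ψ ∈ WW n ℓ a t) :
    mann n x ψ ∈ WW n ℓ (a + 1) (t + 1) := by
  refine Submodule.span_induction (p := fun ψ _ => mann n x ψ ∈ WW n ℓ (a + 1) (t + 1)) ?_ ?_ ?_ ?_ h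
  · rintro _ ⟨u, h1, h2, rfl⟩
    rw [mann_MM]
    by_cases hx : u x = 0
    · simp [hx]
    apply Submodule.smul_mem
    have hle : (Pi.single x 1 : OccT n) ≤ u := by
      intro z
      by_cases h : z = x
      · subst h; simp; omega
      · simp [h]
    have e : u - Pi.single x 1 + Pi.single x 1 = u := tsub_add_cancel_of_le hle
    refine Submodule.subset_span ⟨_, ?_, ?_, rfl⟩
    · rw [← e] at h1
      simp only [Pi.add_apply, Finset.sum_add_distrib, Finset.sum_pi_single', Finset.mem_univ,
        if_true] at h1
      have h3 : ∑ z, (Pi.single x 1 : OccT n) z = 1 := by simp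
      omega
    · have : (Pi.single x 1 : OccT n) 0 ≤ 1 := by
        by_cases h : (0 : BV n) = x
        · subst h; simp
        · simp [h]
      simp only [Pi.sub_apply]; omega
  · simp
  · intro f g _ _ hf hg
    rw [map_add]; exact Submodule.add_mem _ hf hg
  · intro c f _ hf
    rw [map_smul]; exact Submodule.smul_mem _ _ hf

theorem dHop_WW (n ℓ t : ℕ) (y : BV n) (ψ : FockV n) (h : ψ ∈ WW n ℓ 0 t) :
    dHop n ℓ y ψ ∈ WW n ℓ 0 (t + 2) := by
  simp only [dHop, LinearMap.smul_apply, LinearMap.sum_apply, Module.End.mul_apply]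
  apply Submodule.smul_mem
  refine Submodule.sum_mem _ fun x _ => Submodule.sum_mem _ fun x' _ => ?_
  exact mcre_WW _ _ _ _ _ _ (mcre_WW _ _ _ _ _ _ (mann_WW _ _ _ _ _ _ (mann_WW _ _ _ _ _ _ h)))

theorem conProj_mem (n ℓ r : ℕ) (ψ : FockV n) : conProj n ℓ r ψ ∈ WW n ℓ 0 r := by
  rw [conProj, projOn_apply]
  refine Submodule.sum_mem _ fun v _ => ?_
  split_ifs with h
  · apply Submodule.smul_mem
    rw [momFock_eq]
    apply Submodule.smul_mem
    refine Submodule.subset_span ⟨_, ?_, ?_, rfl⟩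
    · simpa using h.1
    · have := h.2
      simp only [] at this ⊢
      omega
  · exact Submodule.zero_mem _

theorem conProj_fix (n ℓ r : ℕ) (ψ : FockV n) (h : ψ ∈ WW n ℓ 0 r) : conProj n ℓ r ψ = ψ := by
  refine Submodule.span_induction (p := fun ψ _ => conProj n ℓ r ψ = ψ) ?_ ?_ ?_ ?_ h
  · rintro _ ⟨u, h1, h2, rfl⟩
    have e : MM n u = (((∏ x : BV n, Real.sqrt ((u x).factorial) : ℝ)) : ℂ) • momFock n u := by
      rw [momFock_eq, smul_smul, ← Complex.ofReal_mul, mul_inv_cancel₀ (nrm_ne n u)]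
      simp
    rw [e, map_smul, conProj, projOn_momFock n ℓ _ u (by simpa using h1) (by omega)]
  · simp
  · intro f g _ _ hf hg
    rw [map_add, hf, hg]
  · intro c f _ hf
    rw [map_smul, hf]

theorem dHop_list_WW (n ℓ : ℕ) (l : List (BV n)) (t : ℕ) (ψ : FockV n) (h : ψ ∈ WW n ℓ 0 t) :
    (l.map fun y => dHop n ℓ y).prod ψ ∈ WW n ℓ 0 (t + 2 * l.length) := by
  induction l with
  | nil => simpa using h
  | cons a l ih =>
    rw [List.map_cons, List.prod_cons, Module.End.mul_apply]
    exact dHop_WW _ _ _ _ _ ih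

/-- hopping operators preserve condensates.
For all `r, k ≥ 0` and `y_1, …, y_k`, `(id − Con_{r+2k}) · H̃_{y_k} ⋯ H̃_{y_1} · Con_r = 0`:
a product of `k` double-momentum hopping operators maps the span of `r`-condensate momentum
Fock states into the span of `(r+2k)`-condensate momentum Fock states. -/
theorem double_hop_preserves_condensate (n ℓ r k : ℕ) (y : Fin k → BV n) :
    ((1 : FockOp n) - conProj n ℓ (r + 2 * k))
        * ((List.ofFn fun i => dHop n ℓ (y i)).reverse.prod)
        * conProj n ℓ r = 0 := by
  apply LinearMap.ext
  intro ψ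
  have h := dHop_list_WW n ℓ (List.ofFn y).reverse r _ (conProj_mem n ℓ r ψ)
  have e : (List.ofFn fun i => dHop n ℓ (y i)).reverse
      = (List.ofFn y).reverse.map fun z => dHop n ℓ z := by
    rw [List.map_reverse, List.map_ofFn]
    rfl
  rw [← e, List.length_reverse, List.length_ofFn] at h
  simp only [Module.End.mul_apply, LinearMap.sub_apply, Module.End.one_apply, LinearMap.zero_apply]
  rw [conProj_fix _ _ _ _ h, sub_self]
end
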